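/- arXiv:1406.1130 — 6 statements merged into one kernel-verified Lean document; each statement's English description precedes it below -/
import Mathlib

section
/- Let L be a countable first-order language and M an L-structure. Let ⫝ be a ternary relation on finite tuples of M satisfying Invariance (Inv), Transitivity (Trans), Symmetry (Sym), Existence (Ex), and Stationarity (Stat). Then ⫝ also satisfies Monotonicity (Mon): for all finite tuples a, b, c, d of M, if a ⫝_b (c,d) then a ⫝_b c and a ⫝_{(b,c)} d. In particular, ⫝ is a stationary independence relation on M. -/
open FirstOrder FirstOrder.Language

universe u v w

section

variable (L : FirstOrder.Language.{u, v}) {M : Type w} [L.Structure M]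

/-- `TpEq L b a a'` says that the finite tuples `a` and `a'` have the same type over
the finite tuple `b` in the `L`-structure `M`: every `L`-formula in `m + n` free
variables holds of `(b, a)` iff it holds of `(b, a')`. -/
def TpEq {m n : ℕ} (b : Fin m → M) (a a' : Fin n → M) : Prop :=
  ∀ φ : L.Formula (Fin (m + n)), φ.Realize (Fin.append b a) ↔ φ.Realize (Fin.append b a')

variable (R : ∀ (n m k : ℕ), (Fin n → M) → (Fin m → M) → (Fin k → M) → Prop)

/-- **Invariance**: `a ⫝_b c` depends only on the type of the concatenated tuple. -/
def IndInv : Prop :=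
  ∀ (n m k : ℕ) (a a' : Fin n → M) (b b' : Fin m → M) (c c' : Fin k → M),
    TpEq L (fun x : Fin 0 => x.elim0) (Fin.append (Fin.append a b) c)
      (Fin.append (Fin.append a' b') c') →
    (R n m k a b c ↔ R n m k a' b' c')

/-- **Monotonicity**: `a ⫝_b (c,d)` implies `a ⫝_b c` and `a ⫝_{(b,c)} d`. -/
def IndMon : Prop :=
  ∀ (n m k l : ℕ) (a : Fin n → M) (b : Fin m → M) (c : Fin k → M) (d : Fin l → M),
    R n m (k + l) a b (Fin.append c d) →
    R n m k a b c ∧ R n (m + k) l a (Fin.append b c) d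

/-- **Transitivity**: `a ⫝_b c` and `a ⫝_{(b,c)} d` imply `a ⫝_b (c,d)`. -/
def IndTrans : Prop :=
  ∀ (n m k l : ℕ) (a : Fin n → M) (b : Fin m → M) (c : Fin k → M) (d : Fin l → M),
    R n m k a b c → R n (m + k) l a (Fin.append b c) d → R n m (k + l) a b (Fin.append c d)

/-- **Symmetry**: `a ⫝_b c` iff `c ⫝_b a`. -/
def IndSym : Prop :=
  ∀ (n m k : ℕ) (a : Fin n → M) (b : Fin m → M) (c : Fin k → M),
    R n m k a b c ↔ R k m n c b a

/-- **Existence**: for all `a, b, c` there is `a'` with `tp(a'/b) = tp(a/b)` and `a' ⫝_b c`. -/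
def IndEx : Prop :=
  ∀ (n m k : ℕ) (a : Fin n → M) (b : Fin m → M) (c : Fin k → M),
    ∃ a' : Fin n → M, TpEq L b a a' ∧ R n m k a' b c

/-- **Stationarity**: independent realizations of the same type over `b` have the
same type over `(b, c)`. -/
def IndStat : Prop :=
  ∀ (n m k : ℕ) (a a' : Fin n → M) (b : Fin m → M) (c : Fin k → M),
    TpEq L b a a' → R n m k a b c → R n m k a' b c →
    TpEq L (Fin.append b c) a a'

/-- `R` is a stationary independence relation on `M`. -/
def IsStationaryIndependenceRel : Prop :=
  IndInv L R ∧ IndMon R ∧ IndTrans R ∧ IndSym R ∧ IndEx L R ∧ IndStat L R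

end

theorem tpEq_transfer (L : FirstOrder.Language.{u, v}) {M : Type w} [L.Structure M]
    {m n p q : ℕ} {b : Fin m → M} {a a' : Fin n → M} {c : Fin p → M} {x x' : Fin q → M}
    (h : TpEq L b a a')
    (hc : ∀ i, ∃ j, c i = Fin.append b a j ∧ c i = Fin.append b a' j)
    (hx : ∀ i, ∃ j, x i = Fin.append b a j ∧ x' i = Fin.append b a' j) :
    TpEq L c x x' := by
  have H : ∀ i, ∃ j, Fin.append c x i = Fin.append b a j ∧
      Fin.append c x' i = Fin.append b a' j := by
    intro i
    refine Fin.addCases (fun i => ?_) (fun i => ?_) i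
    · simpa only [Fin.append_left] using hc i
    · simpa only [Fin.append_right] using hx i
  choose f hf using H
  intro φ
  have e1 : Fin.append c x = Fin.append b a ∘ f := funext fun i => (hf i).1
  have e2 : Fin.append c x' = Fin.append b a' ∘ f := funext fun i => (hf i).2
  rw [e1, e2, ← Formula.realize_relabel, ← Formula.realize_relabel]
  exact h _

/-- same type over `B` containing `b`, `c`: same type of `(a,b,c)`. -/
theorem tpEq_triple (L : FirstOrder.Language.{u, v}) {M : Type w} [L.Structure M]
    {n m k p : ℕ} {B : Fin p → M} {a a' : Fin n → M} {b : Fin m → M} {c : Fin k → M}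
    (h : TpEq L B a a') (hb : ∀ i, ∃ j, b i = B j) (hc : ∀ i, ∃ j, c i = B j) :
    TpEq L (fun x : Fin 0 => x.elim0) (Fin.append (Fin.append a b) c)
      (Fin.append (Fin.append a' b) c) := by
  refine tpEq_transfer L h (fun i => i.elim0) fun i => ?_
  refine Fin.addCases (fun i => ?_) (fun i => ?_) i
  · refine Fin.addCases (fun i => ?_) (fun i => ?_) i
    · exact ⟨Fin.natAdd _ i, by simp only [Fin.append_left, Fin.append_right, and_self]⟩
    · obtain ⟨j, hj⟩ := hb i
      exact ⟨Fin.castAdd _ j, by simp only [Fin.append_left, Fin.append_right, hj, and_self]⟩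
  · obtain ⟨j, hj⟩ := hc i
    exact ⟨Fin.castAdd _ j, by simp only [Fin.append_left, Fin.append_right, hj, and_self]⟩

theorem tpEq_restrict (L : FirstOrder.Language.{u, v}) {M : Type w} [L.Structure M]
    {n m p : ℕ} {B : Fin p → M} {a a' : Fin n → M} {b : Fin m → M}
    (h : TpEq L B a a') (hb : ∀ i, ∃ j, b i = B j) : TpEq L b a a' := by
  refine tpEq_transfer L h (fun i => ?_) fun i => ?_
  · obtain ⟨j, hj⟩ := hb i
    exact ⟨Fin.castAdd _ j, by simp only [Fin.append_left, hj, and_self]⟩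
  · exact ⟨Fin.natAdd _ i, by simp only [Fin.append_right, and_self]⟩

/-- if a ternary relation on finite tuples of an `L`-structure (`L` a
countable language) satisfies Invariance, Transitivity, Symmetry, Existence and
Stationarity, then it also satisfies Monotonicity; in particular it is a stationary
independence relation. -/
theorem mon_of_inv_trans_sym_ex_stat (L : FirstOrder.Language.{u, v})
    [Countable L.Symbols] {M : Type w} [L.Structure M]
    (R : ∀ (n m k : ℕ), (Fin n → M) → (Fin m → M) → (Fin k → M) → Prop)
    (hInv : IndInv L R) (hTrans : IndTrans R) (hSym : IndSym R)
    (hEx : IndEx L R) (hStat : IndStat L R) :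
    IndMon R ∧ IsStationaryIndependenceRel L R := by
  have hMon : IndMon R := by
    intro n m k l a b c d h
    obtain ⟨a1, t1, r1⟩ := hEx n m k a b c
    obtain ⟨a2, t2, r2⟩ := hEx n (m + k) l a1 (Fin.append b c) d
    have hb : ∀ i, ∃ j, b i = Fin.append b c j :=
      fun i => ⟨Fin.castAdd _ i, by rw [Fin.append_left]⟩
    have hc : ∀ i, ∃ j, c i = Fin.append b c j :=
      fun i => ⟨Fin.natAdd _ i, by rw [Fin.append_right]⟩
    have r3 : R n m k a2 b c := (hInv _ _ _ _ _ _ _ _ _ (tpEq_triple L t2 hb hc)).1 r1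
    have r4 := hTrans _ _ _ _ _ _ _ _ r3 r2
    have t3 : TpEq L b a2 a :=
      fun φ => ((t1 φ).trans (tpEq_restrict L t2 hb φ)).symm
    have t4 := hStat _ _ _ _ _ _ _ t3 r4 h
    have hb' : ∀ i, ∃ j, b i = Fin.append b (Fin.append c d) j :=
      fun i => ⟨Fin.castAdd _ i, by rw [Fin.append_left]⟩
    have hc' : ∀ i, ∃ j, c i = Fin.append b (Fin.append c d) j :=
      fun i => ⟨Fin.natAdd _ (Fin.castAdd _ i), by rw [Fin.append_right, Fin.append_left]⟩
    have hd' : ∀ i, ∃ j, d i = Fin.append b (Fin.append c d) j :=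
      fun i => ⟨Fin.natAdd _ (Fin.natAdd _ i), by rw [Fin.append_right, Fin.append_right]⟩
    have hbc : ∀ i, ∃ j, Fin.append b c i = Fin.append b (Fin.append c d) j := by
      intro i
      refine Fin.addCases (fun i => ?_) (fun i => ?_) i
      · simpa only [Fin.append_left] using hb' i
      · simpa only [Fin.append_right] using hc' i
    exact ⟨(hInv _ _ _ _ _ _ _ _ _ (tpEq_triple L t4 hb' hc')).1 r3,
      (hInv _ _ _ _ _ _ _ _ _ (tpEq_triple L t4 hbc hd')).1 r2⟩
  exact ⟨hMon, hInv, hMon, hTrans, hSym, hEx, hStat⟩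
end

section
/- Let L be a countable first-order language and M_0 a countable ultrahomogeneous L-structure such that for all finitely generated substructures A, C of M_0 with a common substructure B, a free amalgam of A and C over B with respect to age(M_0) exists in age(M_0). For finite tuples a, b, c of M_0, define a ⫝_b c if and only if ⟨a b c⟩ is the free amalgam of ⟨a b⟩ and ⟨b c⟩ over ⟨b⟩ with respect to age(M_0), where ⟨x⟩ denotes the substructure of M_0 generated by the entries of the tuples listed. Then ⫝ is a stationary independence relation on M_0. -/
open FirstOrder FirstOrder.Language

universe u v w

/-- `D` is the free amalgam of `A` and `C` over `B` with respect to the class `J`,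
all taken as substructures of an ambient `L`-structure `N`. -/
def IsFreeAmalgamIn (L : FirstOrder.Language.{u, v})
    (J : Set (CategoryTheory.Bundled.{w} L.Structure))
    {N : Type w} [L.Structure N] (A B C D : L.Substructure N) : Prop :=
  A ≤ D ∧ C ≤ D ∧ B = A ⊓ C ∧ A ⊔ C = D ∧
    ∀ E ∈ J, ∀ (f : A →[L] E) (g : C →[L] E),
      (∀ (x : N) (hA : x ∈ A) (hC : x ∈ C), f ⟨x, hA⟩ = g ⟨x, hC⟩) →
      ∃ h : D →[L] E,
        (∀ (x : N) (hx : x ∈ A) (hx' : x ∈ D), h ⟨x, hx'⟩ = f ⟨x, hx⟩) ∧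
        (∀ (x : N) (hx : x ∈ C) (hx' : x ∈ D), h ⟨x, hx'⟩ = g ⟨x, hx⟩)

/-- For every pair of finitely generated substructures `A`, `C` of `M` with a common
substructure `B`, a free amalgam of `A` and `C` over `B` with respect to `age(M)`
exists in `age(M)`. -/
def HasFreeAmalgamsInAge (L : FirstOrder.Language.{u, v}) (M : Type w) [L.Structure M] : Prop :=
  ∀ A C B : L.Substructure M, A.FG → C.FG → ∀ (hBA : B ≤ A) (hBC : B ≤ C),
    ∃ D ∈ L.age M, ∃ (f0 : A ↪[L] D) (f1 : C ↪[L] D),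
      f0.comp (Substructure.inclusion hBA) = f1.comp (Substructure.inclusion hBC) ∧
      IsFreeAmalgamIn L (L.age M) f0.toHom.range
        ((f0.comp (Substructure.inclusion hBA)).toHom.range) f1.toHom.range ⊤

/-- The substructure of `M` generated by the entries of a finite family of tuples. -/
def genBy (L : FirstOrder.Language.{u, v}) {M : Type w} [L.Structure M]
    (s : Set M) : L.Substructure M :=
  Substructure.closure L s


section Helpers

variable {L : FirstOrder.Language.{u, v}}

theorem fam_map {J : Set (CategoryTheory.Bundled.{w} L.Structure)}
    {N M : Type w} [L.Structure N] [L.Structure M] (e : N ↪[L] M)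
    {A B C D : L.Substructure N} (h : IsFreeAmalgamIn L J A B C D) :
    IsFreeAmalgamIn L J (A.map e.toHom) (B.map e.toHom) (C.map e.toHom) (D.map e.toHom) := by
  obtain ⟨h1, h2, h3, h4, h5⟩ := h
  refine ⟨Substructure.monotone_map h1, Substructure.monotone_map h2, ?_, ?_, ?_⟩
  · subst h3
    apply SetLike.coe_injective
    exact Set.image_inter e.injective
  · rw [← h4, Substructure.map_sup]
  · intro E hE f g hfg
    obtain ⟨k, hk1, hk2⟩ := h5 E hE
      (f.comp (e.substructureEquivMap A).toHom) (g.comp (e.substructureEquivMap C).toHom)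
      (fun x hA hC => hfg (e x) ⟨x, hA, rfl⟩ ⟨x, hC, rfl⟩)
    refine ⟨k.comp (e.substructureEquivMap D).symm.toHom, ?_, ?_⟩
    · rintro _ ⟨x, hx, rfl⟩ hx'
      have : (e.substructureEquivMap D).symm ⟨e x, hx'⟩ = ⟨x, h1 hx⟩ := by
        apply (e.substructureEquivMap D).injective
        exact (e.substructureEquivMap D).apply_symm_apply ⟨e x, hx'⟩
      change k ((e.substructureEquivMap D).symm ⟨e x, hx'⟩) = _
      rw [this]
      exact hk1 x hx _
    · rintro _ ⟨x, hx, rfl⟩ hx'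
      have : (e.substructureEquivMap D).symm ⟨e x, hx'⟩ = ⟨x, h2 hx⟩ := by
        apply (e.substructureEquivMap D).injective
        exact (e.substructureEquivMap D).apply_symm_apply ⟨e x, hx'⟩
      change k ((e.substructureEquivMap D).symm ⟨e x, hx'⟩) = _
      rw [this]
      exact hk2 x hx _

variable {M : Type w} [L.Structure M]

theorem fam_map_fix (σ : M ≃[L] M) (B : L.Substructure M) (h : ∀ x ∈ B, σ x = x) :
    B.map σ.toEmbedding.toHom = B := by
  ext x
  constructor
  · rintro ⟨y, hy, rfl⟩
    change σ y ∈ B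
    rw [h y hy]; exact hy
  · intro hx
    exact ⟨x, hx, h x hx⟩

theorem fam_map_symm (σ : M ≃[L] M) (A : L.Substructure M) :
    (A.map σ.toEmbedding.toHom).map σ.symm.toEmbedding.toHom = A := by
  ext x
  constructor
  · rintro ⟨_, ⟨y, hy, rfl⟩, rfl⟩
    change σ.symm (σ y) ∈ A
    rw [FirstOrder.Language.Equiv.symm_apply_apply]; exact hy
  · intro hx
    exact ⟨σ x, ⟨x, hx, rfl⟩, σ.symm_apply_apply x⟩

theorem fam_symm {J : Set (CategoryTheory.Bundled.{w} L.Structure)} {A B C D : L.Substructure M}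
    (h : IsFreeAmalgamIn L J A B C D) : IsFreeAmalgamIn L J C B A D := by
  obtain ⟨h1, h2, h3, h4, h5⟩ := h
  refine ⟨h2, h1, by rw [h3, inf_comm], by rw [sup_comm, h4], ?_⟩
  intro E hE f g hfg
  obtain ⟨k, a, b⟩ := h5 E hE g f (fun x ha hc => (hfg x hc ha).symm)
  exact ⟨k, b, a⟩

theorem fam_ex (hHom : L.IsUltrahomogeneous M) (hFA : HasFreeAmalgamsInAge L M)
    {A B C : L.Substructure M} (hA : A.FG) (hC : C.FG) (hBA : B ≤ A) (hBC : B ≤ C) :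
    ∃ σ : M ≃[L] M, (∀ x ∈ B, σ x = x) ∧
      IsFreeAmalgamIn L (L.age M) (A.map σ.toEmbedding.toHom) B C
        (A.map σ.toEmbedding.toHom ⊔ C) := by
  obtain ⟨D, ⟨_, ⟨e⟩⟩, f0, f1, h01, hfa⟩ := hFA A C B hA hC hBA hBC
  obtain ⟨g, hg⟩ := hHom C hC (e.comp f1)
  have hg' : ∀ x : C, e (f1 x) = g x := fun x => congrArg (fun k => k x) hg
  let e' : D ↪[L] M := g.symm.toEmbedding.comp e
  have he1 : ∀ x : C, e' (f1 x) = x := fun x => by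
    change g.symm (e (f1 x)) = x
    rw [hg', FirstOrder.Language.Equiv.symm_apply_apply]
  obtain ⟨σ, hσ⟩ := hHom A hA (e'.comp f0)
  have hσ' : ∀ x : A, e' (f0 x) = σ x := fun x => congrArg (fun k => k x) hσ
  have h01' : ∀ x (hx : x ∈ B), f0 ⟨x, hBA hx⟩ = f1 ⟨x, hBC hx⟩ := fun x hx =>
    congrArg (fun k => k ⟨x, hx⟩) h01
  have h0 : f0.toHom.range.map e'.toHom = A.map σ.toEmbedding.toHom := by
    ext y; constructor
    · rintro ⟨_, ⟨x, rfl⟩, rfl⟩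
      exact ⟨x, x.2, (hσ' x).symm⟩
    · rintro ⟨x, hx, rfl⟩
      exact ⟨f0 ⟨x, hx⟩, ⟨⟨x, hx⟩, rfl⟩, hσ' ⟨x, hx⟩⟩
  have h1 : f1.toHom.range.map e'.toHom = C := by
    ext y; constructor
    · rintro ⟨_, ⟨x, rfl⟩, rfl⟩
      have := x.2
      rw [← he1 x] at this
      exact this
    · intro hx
      exact ⟨f1 ⟨y, hx⟩, ⟨⟨y, hx⟩, rfl⟩, he1 ⟨y, hx⟩⟩
  have h2 : ((f0.comp (Substructure.inclusion hBA)).toHom.range).map e'.toHom = B := by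
    ext y; constructor
    · rintro ⟨_, ⟨x, rfl⟩, rfl⟩
      change e' (f0 ⟨x, hBA x.2⟩) ∈ B
      rw [h01' x x.2, he1]
      exact x.2
    · intro hx
      refine ⟨f0 ⟨y, hBA hx⟩, ⟨⟨y, hx⟩, rfl⟩, ?_⟩
      change e' (f0 ⟨y, hBA hx⟩) = y
      rw [h01' y hx, he1]
  refine ⟨σ, ?_, ?_⟩
  · intro x hx
    rw [← hσ' ⟨x, hBA hx⟩, h01' x hx, he1]
  · have := fam_map e' hfa
    rw [h0, h1, h2] at this
    have h4 := this.2.2.2.1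
    rw [← h4] at this
    exact this

theorem fam_hom_eq {A C : L.Substructure M}
    (p : (A ⊔ C : L.Substructure M) →[L] (A ⊔ C : L.Substructure M))
    (hA : ∀ x (_ : x ∈ A) (h : x ∈ A ⊔ C), (p ⟨x, h⟩ : M) = x)
    (hC : ∀ x (_ : x ∈ C) (h : x ∈ A ⊔ C), (p ⟨x, h⟩ : M) = x) (y : (A ⊔ C : L.Substructure M)) :
    p y = y := by
  have : A ⊔ C ≤ (p.eqLocus (Hom.id L _)).map (A ⊔ C).subtype.toHom := by
    apply sup_le
    · intro x hx
      exact ⟨⟨x, (le_sup_left : A ≤ A ⊔ C) hx⟩, Subtype.ext (hA x hx _), rfl⟩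
    · intro x hx
      exact ⟨⟨x, (le_sup_right : C ≤ A ⊔ C) hx⟩, Subtype.ext (hC x hx _), rfl⟩
  obtain ⟨z, hz, hzy⟩ := this y.2
  have : z = y := Subtype.ext hzy
  subst this
  exact hz

theorem fam_age {A : L.Substructure M} (hA : A.FG) :
    (⟨A, inferInstance⟩ : CategoryTheory.Bundled.{w} L.Structure) ∈ L.age M :=
  ⟨(Substructure.fg_iff_structure_fg A).1 hA, ⟨A.subtype⟩⟩

theorem fam_stat_hom {A B C : L.Substructure M} (hA : A.FG) (hC : C.FG)
    (σ : M ≃[L] M) (hσ : ∀ x ∈ B, σ x = x) {A' : L.Substructure M}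
    (hA' : A.map σ.toEmbedding.toHom = A')
    (h1 : IsFreeAmalgamIn L (L.age M) A B C (A ⊔ C)) :
    ∃ k : (A ⊔ C : L.Substructure M) →[L] (A' ⊔ C : L.Substructure M),
      (∀ x (_ : x ∈ A) (h : x ∈ A ⊔ C), (k ⟨x, h⟩ : M) = σ x) ∧
      (∀ x (_ : x ∈ C) (h : x ∈ A ⊔ C), (k ⟨x, h⟩ : M) = x) := by
  subst hA'
  obtain ⟨-, -, h3, -, h5⟩ := h1
  obtain ⟨k, hk1, hk2⟩ := h5 ⟨(A.map σ.toEmbedding.toHom ⊔ C : L.Substructure M), inferInstance⟩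
    (fam_age ((hA.map _).sup hC))
    ((σ.toEmbedding.toHom.comp A.subtype.toHom).codRestrict
      (A.map σ.toEmbedding.toHom ⊔ C : L.Substructure M)
      (fun x => (le_sup_left : A.map σ.toEmbedding.toHom ≤ A.map σ.toEmbedding.toHom ⊔ C)
        ⟨x, x.2, rfl⟩))
    (Substructure.inclusion le_sup_right).toHom
    (by
      intro x hxA hxC
      apply Subtype.ext
      exact hσ x (h3 ▸ ⟨hxA, hxC⟩))
  exact ⟨k, fun x hx h => congrArg Subtype.val (hk1 x hx h),
    fun x hx h => congrArg Subtype.val (hk2 x hx h)⟩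

theorem fam_stat (hHom : L.IsUltrahomogeneous M) {A B C : L.Substructure M} (hA : A.FG) (hC : C.FG)
    (σ : M ≃[L] M) (hσ : ∀ x ∈ B, σ x = x)
    (h1 : IsFreeAmalgamIn L (L.age M) A B C (A ⊔ C))
    (h2 : IsFreeAmalgamIn L (L.age M) (A.map σ.toEmbedding.toHom) B C
        (A.map σ.toEmbedding.toHom ⊔ C)) :
    ∃ τ : M ≃[L] M, (∀ x ∈ C, τ x = x) ∧ ∀ x ∈ A, τ x = σ x := by
  obtain ⟨k, hk1, hk2⟩ := fam_stat_hom hA hC σ hσ rfl h1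
  obtain ⟨l, hl1, hl2⟩ := fam_stat_hom (hA.map _) hC σ.symm
    (fun x hx => by rw [← hσ x hx, FirstOrder.Language.Equiv.symm_apply_apply, hσ x hx]) (fam_map_symm σ A) h2
  have hlA : ∀ x (hx : x ∈ A) (h : x ∈ A ⊔ C), l (k ⟨x, h⟩) = ⟨x, h⟩ := by
    intro x hx h
    apply Subtype.ext
    have e : k ⟨x, h⟩ = ⟨σ x, (le_sup_left : A.map σ.toEmbedding.toHom ≤ _) ⟨x, hx, rfl⟩⟩ :=
      Subtype.ext (hk1 x hx h)
    rw [e]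
    exact (hl1 (σ x) ⟨x, hx, rfl⟩ _).trans (σ.symm_apply_apply x)
  have hlC : ∀ x (hx : x ∈ C) (h : x ∈ A ⊔ C), l (k ⟨x, h⟩) = ⟨x, h⟩ := by
    intro x hx h
    apply Subtype.ext
    have e : k ⟨x, h⟩ = ⟨x, (le_sup_right : C ≤ _) hx⟩ :=
      Subtype.ext (hk2 x hx h)
    rw [e, hl2 _ hx]
  have hlk : ∀ y, l (k y) = y := fam_hom_eq (l.comp k)
    (fun x hx h => congrArg Subtype.val (hlA x hx h))
    (fun x hx h => congrArg Subtype.val (hlC x hx h))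
  have hkl : ∀ y, k (l y) = y := by
    refine fam_hom_eq (k.comp l) ?_ ?_
    · rintro _ ⟨x, hx, rfl⟩ h
      have e : (⟨σ.toEmbedding.toHom x, h⟩ : (A.map σ.toEmbedding.toHom ⊔ C : L.Substructure M)) =
        k ⟨x, (le_sup_left : A ≤ A ⊔ C) hx⟩ := Subtype.ext (hk1 x hx _).symm
      rw [Hom.comp_apply, e, hlk, hk1 x hx]
      rfl
    · intro x hx h
      have e : (⟨x, h⟩ : (A.map σ.toEmbedding.toHom ⊔ C : L.Substructure M)) =
        k ⟨x, (le_sup_right : C ≤ A ⊔ C) hx⟩ := Subtype.ext (hk2 x hx _).symm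
      rw [Hom.comp_apply, e, hlk, hk2 x hx]
  let E : (A ⊔ C : L.Substructure M) ↪[L] (A.map σ.toEmbedding.toHom ⊔ C : L.Substructure M) :=
    { toFun := k
      inj' := Function.LeftInverse.injective hlk
      map_fun' := fun f x => k.map_fun f x
      map_rel' := fun r x => by
        refine ⟨fun h => ?_, fun h => k.map_rel r x h⟩
        have := l.map_rel r _ h
        have e : l ∘ k ∘ x = x := funext fun i => hlk (x i)
        rw [← e]; exact this }
  obtain ⟨τ, hτ⟩ := hHom (A ⊔ C) (hA.sup hC) ((Substructure.subtype _).comp E)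
  have hτ' : ∀ y, (k y : M) = τ y := fun y => congrArg (fun k => k y) hτ
  refine ⟨τ, fun x hx => ?_, fun x hx => ?_⟩
  · have := hτ' ⟨x, (le_sup_right : C ≤ A ⊔ C) hx⟩
    rw [hk2 x hx] at this
    exact this.symm
  · have := hτ' ⟨x, (le_sup_left : A ≤ A ⊔ C) hx⟩
    rw [hk1 x hx] at this
    exact this.symm

theorem fam_trans {J : Set (CategoryTheory.Bundled.{w} L.Structure)} {A B C E : L.Substructure M}
    (hCE : C ≤ E)
    (h1 : IsFreeAmalgamIn L J A B C (A ⊔ C)) (h2 : IsFreeAmalgamIn L J (A ⊔ C) C E (A ⊔ C ⊔ E)) :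
    IsFreeAmalgamIn L J A B E (A ⊔ E) := by
  have hs : A ⊔ C ⊔ E = A ⊔ E := by rw [sup_assoc, sup_eq_right.2 hCE]
  rw [hs] at h2
  refine ⟨le_sup_left, le_sup_right, ?_, rfl, ?_⟩
  · rw [h1.2.2.1]
    apply le_antisymm (inf_le_inf_left _ hCE)
    refine le_inf inf_le_left ?_
    conv_rhs => rw [h2.2.2.1]
    exact inf_le_inf_right _ le_sup_left
  · intro X hX f g hfg
    obtain ⟨k, hk1, hk2⟩ := h1.2.2.2.2 X hX f (g.comp (Substructure.inclusion hCE).toHom)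
      (fun x hA hC => hfg x hA (hCE hC))
    obtain ⟨l, hl1, hl2⟩ := h2.2.2.2.2 X hX k g (by
      intro x hx hE
      have hxC : x ∈ C := by rw [h2.2.2.1]; exact ⟨hx, hE⟩
      rw [hk2 x hxC]
      rfl)
    refine ⟨l, fun x hx hx' => ?_, hl2⟩
    rw [hl1 x ((le_sup_left : A ≤ A ⊔ C) hx), hk1 x hx]

theorem fam_mon (hHom : L.IsUltrahomogeneous M) (hFA : HasFreeAmalgamsInAge L M)
    {A B C E : L.Substructure M} (hA : A.FG) (hC : C.FG) (hE : E.FG) (hBC : B ≤ C) (hCE : C ≤ E)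
    (h : IsFreeAmalgamIn L (L.age M) A B E (A ⊔ E)) :
    IsFreeAmalgamIn L (L.age M) A B C (A ⊔ C) ∧
    IsFreeAmalgamIn L (L.age M) (A ⊔ C) C E (A ⊔ C ⊔ E) := by
  have hBA : B ≤ A := by rw [h.2.2.1]; exact inf_le_left
  obtain ⟨σ, hσ, hσa⟩ := fam_ex hHom hFA hA hC hBA hBC
  obtain ⟨τ, hτ, hτa⟩ := fam_ex hHom hFA ((hA.map σ.toEmbedding.toHom).sup hC) hE
    (le_sup_right : C ≤ _) hCE
  have h1 := fam_map τ.toEmbedding hσa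
  rw [Substructure.map_sup, fam_map_fix τ C hτ, fam_map_fix τ B (fun x hx => hτ x (hBC hx))] at h1
  rw [Substructure.map_sup, fam_map_fix τ C hτ] at hτa
  have hm : (A.map σ.toEmbedding.toHom).map τ.toEmbedding.toHom
      = A.map (τ.comp σ).toEmbedding.toHom := by
    rw [Substructure.map_map]; rfl
  rw [hm] at h1 hτa
  have h2 := fam_trans hCE h1 hτa
  obtain ⟨ρ, hρ, hρA⟩ := fam_stat hHom hA hE (τ.comp σ)
    (fun x hx => by
      change τ (σ x) = x
      rw [hσ x hx, hτ x (hBC hx)]) h h2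
  have hm2 : A.map (τ.comp σ).toEmbedding.toHom = A.map ρ.toEmbedding.toHom := by
    ext y; constructor
    · rintro ⟨x, hx, rfl⟩
      exact ⟨x, hx, hρA x hx⟩
    · rintro ⟨x, hx, rfl⟩
      exact ⟨x, hx, (hρA x hx).symm⟩
  have hρ' : ∀ x ∈ E, ρ.symm x = x := fun x hx => by
    rw [← hρ x hx, FirstOrder.Language.Equiv.symm_apply_apply, hρ x hx]
  rw [hm2] at h1 hτa
  have g1 := fam_map ρ.symm.toEmbedding h1
  have g2 := fam_map ρ.symm.toEmbedding hτa
  rw [Substructure.map_sup, fam_map_symm, fam_map_fix ρ.symm C (fun x hx => hρ' x (hCE hx)),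
    fam_map_fix ρ.symm B (fun x hx => hρ' x (hCE (hBC hx)))] at g1
  rw [Substructure.map_sup, Substructure.map_sup, Substructure.map_sup, fam_map_symm,
    fam_map_fix ρ.symm C (fun x hx => hρ' x (hCE hx)), fam_map_fix ρ.symm E hρ'] at g2
  exact ⟨g1, g2⟩

theorem fam_tp (hHom : L.IsUltrahomogeneous M) {n : ℕ} (x x' : Fin n → M)
    (h : ∀ φ : L.Formula (Fin n), φ.Realize x ↔ φ.Realize x') :
    ∃ σ : M ≃[L] M, ∀ i, σ (x i) = x' i := by
  have hex : ∀ y : Substructure.closure L (Set.range x), ∃ t : L.Term (Fin n), t.realize x = y := by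
    rintro ⟨y, hy⟩
    obtain ⟨t, ht⟩ := Substructure.mem_closure_iff_exists_term.1 hy
    refine ⟨t.relabel (fun z => z.2.choose), ?_⟩
    rw [Term.realize_relabel]
    refine Eq.trans ?_ ht
    congr 1
    funext z
    exact z.2.choose_spec
  choose T hT using hex
  have heq : ∀ s t : L.Term (Fin n), s.realize x = t.realize x ↔ s.realize x' = t.realize x' := by
    intro s t
    have := h (s.equal t)
    rwa [Formula.realize_equal, Formula.realize_equal] at this
  let E : Substructure.closure L (Set.range x) ↪[L] M :=
    { toFun := fun y => (T y).realize x'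
      inj' := fun y z hyz => Subtype.ext (by
        rw [← hT y, ← hT z]
        exact (heq _ _).2 hyz)
      map_fun' := fun {k} f y => by
        change (T _).realize x' = (Term.func f (fun i => T (y i))).realize x'
        rw [← heq, hT]
        change Structure.funMap f (fun i => (y i : M)) = _
        rw [Term.realize]
        congr 1
        funext i
        exact (hT (y i)).symm
      map_rel' := fun {k} r y => by
        have := h (r.formula (fun i => T (y i)))
        rw [Formula.realize_rel, Formula.realize_rel] at this
        refine this.symm.trans ?_
        simp only [hT]
        rfl }
  obtain ⟨σ, hσ⟩ := hHom _ (Substructure.fg_closure (Set.finite_range x)) E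
  refine ⟨σ, fun i => ?_⟩
  have hi : x i ∈ Substructure.closure L (Set.range x) := Substructure.subset_closure ⟨i, rfl⟩
  have h1 : (T ⟨x i, hi⟩).realize x' = σ (x i) := congrArg (fun k => k ⟨x i, hi⟩) hσ
  rw [← h1]
  exact (heq (T ⟨x i, hi⟩) (Term.var i)).1 (hT ⟨x i, hi⟩)

theorem fam_tp' (σ : M ≃[L] M) {n : ℕ} (x x' : Fin n → M) (h : ∀ i, σ (x i) = x' i)
    (φ : L.Formula (Fin n)) : φ.Realize x ↔ φ.Realize x' := by
  have : x' = σ ∘ x := funext fun i => (h i).symm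
  rw [this]
  exact (StrongHomClass.realize_formula σ φ).symm

theorem fam_tp_append (hHom : L.IsUltrahomogeneous M) {m n : ℕ} (b : Fin m → M) (a a' : Fin n → M) :
    TpEq L b a a' ↔ ∃ σ : M ≃[L] M, (∀ i, σ (b i) = b i) ∧ ∀ i, σ (a i) = a' i := by
  constructor
  · intro h
    obtain ⟨σ, hσ⟩ := fam_tp hHom _ _ h
    refine ⟨σ, fun i => ?_, fun i => ?_⟩
    · simpa using hσ (Fin.castAdd n i)
    · simpa using hσ (Fin.natAdd m i)
  · rintro ⟨σ, h1, h2⟩ φ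
    refine fam_tp' σ _ _ (fun i => ?_) φ
    refine Fin.addCases (fun i => ?_) (fun i => ?_) i
    · simpa using h1 i
    · simpa using h2 i

theorem fam_range_append {m n : ℕ} (b : Fin m → M) (a : Fin n → M) :
    Set.range (Fin.append b a) = Set.range b ∪ Set.range a := by
  ext y
  constructor
  · rintro ⟨i, rfl⟩
    refine Fin.addCases (fun i => ?_) (fun i => ?_) i
    · simp
    · simp
  · rintro (⟨i, rfl⟩ | ⟨i, rfl⟩)
    · exact ⟨Fin.castAdd n i, by simp⟩
    · exact ⟨Fin.natAdd m i, by simp⟩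

theorem fam_gen_map (σ : M ≃[L] M) (s : Set M) :
    (genBy L s).map σ.toEmbedding.toHom = genBy L (σ '' s) :=
  (Substructure.closure_image σ.toEmbedding.toHom).symm

theorem fam_fix_closure (σ : M ≃[L] M) (s : Set M) (h : ∀ x ∈ s, σ x = x) :
    ∀ x ∈ genBy L s, σ x = x := by
  have : genBy L s ≤ σ.toEmbedding.toHom.eqLocus (Hom.id L M) :=
    Substructure.closure_le.2 h
  exact fun x hx => this hx

end Helpers

/-- if `M₀` is a countable ultrahomogeneous structure over a countable
language whose age has free amalgamation, then `a ⫝_b c` iff `⟨a b c⟩` is the free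
amalgam of `⟨a b⟩` and `⟨b c⟩` over `⟨b⟩` (w.r.t. `age(M₀)`) defines a stationary
independence relation on `M₀`. -/
theorem freeAmalgam_isStationaryIndependenceRel (L : FirstOrder.Language.{u, v})
    [Countable L.Symbols] (M₀ : Type w) [L.Structure M₀] [Countable M₀]
    (hHom : L.IsUltrahomogeneous M₀)
    (hFA : HasFreeAmalgamsInAge L M₀) :
    IsStationaryIndependenceRel L
      (fun (n m k : ℕ) (a : Fin n → M₀) (b : Fin m → M₀) (c : Fin k → M₀) =>
        IsFreeAmalgamIn L (L.age M₀)
          (genBy L (Set.range a ∪ Set.range b))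
          (genBy L (Set.range b))
          (genBy L (Set.range b ∪ Set.range c))
          (genBy L (Set.range a ∪ Set.range b ∪ Set.range c))) := by
  have fg : ∀ {n m : ℕ} (a : Fin n → M₀) (b : Fin m → M₀),
      (genBy L (Set.range a ∪ Set.range b)).FG := fun a b =>
    Substructure.fg_closure ((Set.finite_range a).union (Set.finite_range b))
  have gs : ∀ {n m k : ℕ} (a : Fin n → M₀) (b : Fin m → M₀) (c : Fin k → M₀),
      genBy L (Set.range a ∪ Set.range b ∪ Set.range c) =
      genBy L (Set.range a ∪ Set.range b) ⊔ genBy L (Set.range b ∪ Set.range c) := by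
    intro n m k a b c
    rw [genBy, genBy, genBy, ← Substructure.closure_union]
    congr 1
    ext; simp only [Set.mem_union]; tauto
  have mono : ∀ {s t : Set M₀}, s ⊆ t → genBy L s ≤ genBy L t := fun h =>
    Substructure.closure_mono h
  have inv1 : ∀ (σ : M₀ ≃[L] M₀) (n m k : ℕ) (a a' : Fin n → M₀) (b b' : Fin m → M₀)
      (c c' : Fin k → M₀), (∀ i, σ (a i) = a' i) → (∀ i, σ (b i) = b' i) →
      (∀ i, σ (c i) = c' i) →
      IsFreeAmalgamIn L (L.age M₀)
          (genBy L (Set.range a ∪ Set.range b))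
          (genBy L (Set.range b))
          (genBy L (Set.range b ∪ Set.range c))
          (genBy L (Set.range a ∪ Set.range b ∪ Set.range c)) →
      IsFreeAmalgamIn L (L.age M₀)
          (genBy L (Set.range a' ∪ Set.range b'))
          (genBy L (Set.range b'))
          (genBy L (Set.range b' ∪ Set.range c'))
          (genBy L (Set.range a' ∪ Set.range b' ∪ Set.range c')) := by
    intro σ n m k a a' b b' c c' ha hb hc h
    have h' := fam_map σ.toEmbedding h
    obtain rfl : σ ∘ a = a' := funext ha
    obtain rfl : σ ∘ b = b' := funext hb
    obtain rfl : σ ∘ c = c' := funext hc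
    simp only [fam_gen_map, Set.image_union, ← Set.range_comp] at h'
    exact h'
  -- rewriting for monotonicity and transitivity
  have key : ∀ {n m k l : ℕ} (a : Fin n → M₀) (b : Fin m → M₀) (c : Fin k → M₀) (d : Fin l → M₀),
      (Set.range b ∪ (Set.range c ∪ Set.range d) = Set.range b ∪ Set.range c ∪ Set.range d) ∧
      genBy L (Set.range a ∪ (Set.range b ∪ Set.range c)) =
      genBy L (Set.range a ∪ Set.range b) ⊔ genBy L (Set.range b ∪ Set.range c) ∧
      genBy L (Set.range a ∪ (Set.range b ∪ Set.range c) ∪ Set.range d) =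
      genBy L (Set.range a ∪ Set.range b) ⊔ genBy L (Set.range b ∪ Set.range c)
        ⊔ genBy L (Set.range b ∪ Set.range c ∪ Set.range d) ∧
      genBy L (Set.range a ∪ Set.range b ∪ (Set.range c ∪ Set.range d)) =
      genBy L (Set.range a ∪ Set.range b) ⊔ genBy L (Set.range b ∪ Set.range c ∪ Set.range d) := by
    intro n m k l a b c d
    refine ⟨(Set.union_assoc _ _ _).symm, ?_, ?_, ?_⟩
    all_goals
      simp only [genBy, ← Substructure.closure_union]
      congr 1
      ext; simp only [Set.mem_union]; tauto
  refine ⟨?_, ?_, ?_, ?_, ?_, ?_⟩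
  · intro n m k a a' b b' c c' h
    obtain ⟨σ, -, hσ⟩ := (fam_tp_append hHom _ _ _).1 h
    have ha : ∀ i, σ (a i) = a' i := fun i => by
      simpa using hσ (Fin.castAdd k (Fin.castAdd m i))
    have hb : ∀ i, σ (b i) = b' i := fun i => by
      simpa using hσ (Fin.castAdd k (Fin.natAdd n i))
    have hc : ∀ i, σ (c i) = c' i := fun i => by
      simpa using hσ (Fin.natAdd (n + m) i)
    exact ⟨inv1 σ n m k a a' b b' c c' ha hb hc,
      inv1 σ.symm n m k a' a b' b c' c (fun i => by rw [← ha, FirstOrder.Language.Equiv.symm_apply_apply])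
        (fun i => by rw [← hb, FirstOrder.Language.Equiv.symm_apply_apply])
        (fun i => by rw [← hc, FirstOrder.Language.Equiv.symm_apply_apply])⟩
  · intro n m k l a b c d h
    obtain ⟨k1, k2, k3, k4⟩ := key a b c d
    simp only [fam_range_append] at h ⊢
    rw [k4, k1] at h
    rw [k2, k3, gs]
    exact fam_mon hHom hFA (fg a b) (fg b c)
      (Substructure.fg_closure (((Set.finite_range b).union (Set.finite_range c)).union
        (Set.finite_range d)))
      (mono Set.subset_union_left) (mono Set.subset_union_left) h
  · intro n m k l a b c d h1 h2
    obtain ⟨k1, k2, k3, k4⟩ := key a b c d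
    simp only [fam_range_append] at h1 h2 ⊢
    rw [k2, k3] at h2
    rw [gs] at h1
    rw [k4, k1]
    exact fam_trans (mono Set.subset_union_left) h1 h2
  · have : ∀ (n m k : ℕ) (a : Fin n → M₀) (b : Fin m → M₀) (c : Fin k → M₀),
      IsFreeAmalgamIn L (L.age M₀)
          (genBy L (Set.range a ∪ Set.range b))
          (genBy L (Set.range b))
          (genBy L (Set.range b ∪ Set.range c))
          (genBy L (Set.range a ∪ Set.range b ∪ Set.range c)) →
      IsFreeAmalgamIn L (L.age M₀)
          (genBy L (Set.range c ∪ Set.range b))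
          (genBy L (Set.range b))
          (genBy L (Set.range b ∪ Set.range a))
          (genBy L (Set.range c ∪ Set.range b ∪ Set.range a)) := by
      intro n m k a b c h
      have h' := fam_symm h
      have e : Set.range c ∪ Set.range b ∪ Set.range a =
        Set.range a ∪ Set.range b ∪ Set.range c := by
        ext; simp only [Set.mem_union]; tauto
      rw [e, Set.union_comm (Set.range c), Set.union_comm (Set.range b) (Set.range a)]
      exact h'
    exact fun n m k a b c => ⟨this n m k a b c, this k m n c b a⟩
  · intro n m k a b c
    obtain ⟨σ, hσ, hfa⟩ := fam_ex hHom hFA (fg a b) (fg b c)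
      (mono (Set.subset_union_right : Set.range b ⊆ _))
      (mono (Set.subset_union_left : Set.range b ⊆ _))
    have hb : ∀ i, σ (b i) = b i := fun i => hσ _ (Substructure.subset_closure ⟨i, rfl⟩)
    refine ⟨σ ∘ a, (fam_tp_append hHom _ _ _).2 ⟨σ, hb, fun i => rfl⟩, ?_⟩
    have e : σ ∘ b = b := funext hb
    rw [fam_gen_map, Set.image_union, ← Set.range_comp, ← Set.range_comp, e, ← gs] at hfa
    exact hfa
  · intro n m k a a' b c h h1 h2
    obtain ⟨σ, hb, ha⟩ := (fam_tp_append hHom _ _ _).1 h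
    have e : σ ∘ b = b := funext hb
    have e' : σ ∘ a = a' := funext ha
    have hm : (genBy L (Set.range a ∪ Set.range b)).map σ.toEmbedding.toHom =
        genBy L (Set.range a' ∪ Set.range b) := by
      rw [fam_gen_map, Set.image_union, ← Set.range_comp, ← Set.range_comp, e, e']
    simp only [gs] at h1 h2
    rw [← hm] at h2
    obtain ⟨τ, hτ1, hτ2⟩ := fam_stat hHom (fg a b) (fg b c) σ
      (fam_fix_closure σ _ (by rintro _ ⟨i, rfl⟩; exact hb i)) h1 h2
    refine (fam_tp_append hHom _ _ _).2 ⟨τ, fun i => ?_, fun i => ?_⟩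
    · apply hτ1
      apply Substructure.subset_closure
      rw [← fam_range_append]
      exact ⟨i, rfl⟩
    · rw [hτ2 _ (Substructure.subset_closure (Or.inl ⟨i, rfl⟩)), ha]
end

section
/- Let L be a first-order language, J a class of L-structures, and D an L-structure with substructures A, B, C, C' such that B ⊆ A, B ⊆ C ⊆ C'. Suppose the substructure D₁ of D generated by A ∪ C is the free amalgam of A and C over B with respect to J, and that D is generated by D₁ ∪ C' and is the free amalgam of D₁ and C' over C with respect to J. Then D is the free amalgam of A and C' over B with respect to J; in particular A ∩ C' = B. -/
open FirstOrder FirstOrder.Language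

universe u v w

/-- transitivity of free amalgamation.  If `D₁ = ⟨A ∪ C⟩` is the free
amalgam of `A` and `C` over `B`, and the ambient structure `D` is generated by
`D₁ ∪ C'` and is the free amalgam of `D₁` and `C'` over `C`, then `D` is the free
amalgam of `A` and `C'` over `B`; in particular `A ⊓ C' = B`. -/
theorem freeAmalgam_trans (L : FirstOrder.Language.{u, v}) (J : Set (CategoryTheory.Bundled.{w} L.Structure))
    (D : Type w) [L.Structure D] (A B C C' : L.Substructure D)
    (hBA : B ≤ A) (hBC : B ≤ C) (hCC' : C ≤ C')
    (h1 : IsFreeAmalgamIn L J A B C (A ⊔ C))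
    (h2 : IsFreeAmalgamIn L J (A ⊔ C) C C' ⊤) :
    IsFreeAmalgamIn L J A B C' ⊤ := by
  obtain ⟨-, -, hB, -, e1⟩ := h1
  obtain ⟨-, -, hC, hT, e2⟩ := h2
  refine ⟨le_top, le_top, ?_, ?_, ?_⟩
  · apply le_antisymm
    · exact le_inf hBA (hBC.trans hCC')
    · intro x hx
      have hx' := FirstOrder.Language.Substructure.mem_inf.1 hx
      have hxC : x ∈ C := by
        rw [hC]
        exact FirstOrder.Language.Substructure.mem_inf.2
          ⟨(le_sup_left : A ≤ A ⊔ C) hx'.1, hx'.2⟩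
      rw [hB]
      exact FirstOrder.Language.Substructure.mem_inf.2 ⟨hx'.1, hxC⟩
  · rw [← hT, sup_assoc, sup_eq_right.2 hCC']
  · intro E hE f g hfg
    obtain ⟨k, kA, kC⟩ := e1 E hE f
      (g.comp (FirstOrder.Language.Substructure.inclusion hCC').toHom)
      (fun x hA hxC => hfg x hA (hCC' hxC))
    obtain ⟨h, hk, hg⟩ := e2 E hE k g (by
      intro x hx hx'
      have hxC : x ∈ C := by
        rw [hC]
        exact FirstOrder.Language.Substructure.mem_inf.2 ⟨hx, hx'⟩
      exact kC x hxC hx)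
    refine ⟨h, fun x hx hx' => ?_, hg⟩
    have hs : x ∈ A ⊔ C := (le_sup_left : A ≤ A ⊔ C) hx
    exact (hk x hs hx').trans (kA x hx hs)
end

section
/- Let L be a countable first-order language and M_0 a countable ultrahomogeneous L-structure such that for all finitely generated substructures A, C of M_0 with a common substructure B, a free amalgam of A and C over B with respect to age(M_0) exists in age(M_0). Then Aut(M_0) is universal for the automorphism groups of substructures of M_0: for every substructure N of M_0 there is an injective group homomorphism from Aut(N) into Aut(M_0), where Aut denotes the group of L-automorphisms under composition. -/
open FirstOrder FirstOrder.Language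

universe u v w

namespace AutUniv

section basics
variable {L : FirstOrder.Language.{u, v}} {M P Q : Type w} [L.Structure M] [L.Structure P]
  [L.Structure Q]

open Substructure Structure

theorem agree_closure {A C : L.Substructure M} (f : A →[L] P) (g : C →[L] P) (b : Set M)
    (h : ∀ x ∈ b, ∃ (hA : x ∈ A) (hC : x ∈ C), f ⟨x, hA⟩ = g ⟨x, hC⟩) {x : M}
    (hx : x ∈ closure L b) : ∃ (hA : x ∈ A) (hC : x ∈ C), f ⟨x, hA⟩ = g ⟨x, hC⟩ := by
  refine closure_induction hx h ?_
  intro n F y hy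
  have hy' : ∀ i, ∃ (hA : y i ∈ A) (hC : y i ∈ C), f ⟨y i, hA⟩ = g ⟨y i, hC⟩ := hy
  choose hA hC he using hy'
  refine ⟨A.fun_mem F y hA, C.fun_mem F y hC, ?_⟩
  have h1 := f.map_fun F (fun i => ⟨y i, hA i⟩)
  have h2 := g.map_fun F (fun i => ⟨y i, hC i⟩)
  have h3 : (f ∘ fun i => (⟨y i, hA i⟩ : A)) = (g ∘ fun i => (⟨y i, hC i⟩ : C)) := funext he
  rw [h3] at h1
  exact h1.trans h2.symm

theorem fa (hHom : L.IsUltrahomogeneous M) (hFA : HasFreeAmalgamsInAge L M)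
    (A C B : L.Substructure M) (hA : A.FG) (hC : C.FG) (hBA : B ≤ A) (hBC : B ≤ C) :
    ∃ (μ ν : M ≃[L] M) (D : L.Substructure M), D.FG ∧ (∀ b ∈ B, μ b = ν b) ∧
      (∀ x ∈ A, μ x ∈ D) ∧ (∀ x ∈ C, ν x ∈ D) ∧
      ∀ (f : A →[L] M) (g : C →[L] M),
        (∀ x (hx : x ∈ B), f ⟨x, hBA hx⟩ = g ⟨x, hBC hx⟩) →
        ∃ h : D →[L] M, (∀ x (hx : x ∈ A) (hx' : μ x ∈ D), h ⟨μ x, hx'⟩ = f ⟨x, hx⟩) ∧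
          (∀ x (hx : x ∈ C) (hx' : ν x ∈ D), h ⟨ν x, hx'⟩ = g ⟨x, hx⟩) := by
  obtain ⟨D0, ⟨hD0, ⟨δ⟩⟩, f0, f1, hcomp, -, -, hB, -, hfree⟩ := hFA A C B hA hC hBA hBC
  obtain ⟨μ, hμ⟩ := hHom A hA (δ.comp f0)
  obtain ⟨ν, hν⟩ := hHom C hC (δ.comp f1)
  have hμ' : ∀ x (hx : x ∈ A), μ x = δ (f0 ⟨x, hx⟩) := fun x hx =>
    (DFunLike.congr_fun hμ ⟨x, hx⟩).symm
  have hν' : ∀ x (hx : x ∈ C), ν x = δ (f1 ⟨x, hx⟩) := fun x hx =>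
    (DFunLike.congr_fun hν ⟨x, hx⟩).symm
  have hc' : ∀ x (hx : x ∈ B), f0 ⟨x, hBA hx⟩ = f1 ⟨x, hBC hx⟩ := fun x hx =>
    DFunLike.congr_fun hcomp ⟨x, hx⟩
  refine ⟨μ, ν, δ.toHom.range, hD0.range _, ?_, ?_, ?_, ?_⟩
  · intro b hb
    rw [hμ' b (hBA hb), hν' b (hBC hb), hc' b hb]
  · intro x hx; rw [hμ' x hx]; exact ⟨_, rfl⟩
  · intro x hx; rw [hν' x hx]; exact ⟨_, rfl⟩
  · intro f g hfg
    let E : L.Substructure M := f.range ⊔ g.range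
    have hE : E.FG := ((A.fg_iff_structure_fg.1 hA).range f).sup ((C.fg_iff_structure_fg.1 hC).range g)
    let f' : A →[L] E := f.codRestrict E fun c => (le_sup_left : f.range ≤ E) ⟨c, rfl⟩
    let g' : C →[L] E := g.codRestrict E fun c => (le_sup_right : g.range ≤ E) ⟨c, rfl⟩
    have hEage : (CategoryTheory.Bundled.of E : CategoryTheory.Bundled.{w} L.Structure) ∈ L.age M :=
      ⟨E.fg_iff_structure_fg.1 hE, ⟨E.subtype⟩⟩
    have e0 : ∀ a, f0.equivRange.symm ⟨f0 a, ⟨a, rfl⟩⟩ = a := fun a =>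
      f0.equivRange.symm_apply_apply a
    have e1 : ∀ a, f1.equivRange.symm ⟨f1 a, ⟨a, rfl⟩⟩ = a := fun a =>
      f1.equivRange.symm_apply_apply a
    have ed : ∀ a, δ.equivRange.symm ⟨δ a, ⟨a, rfl⟩⟩ = a := fun a =>
      δ.equivRange.symm_apply_apply a
    obtain ⟨h, hh0, hh1⟩ := hfree _ hEage (f'.comp f0.equivRange.symm.toHom)
      (g'.comp f1.equivRange.symm.toHom) (by
        intro x hxA hxC
        have : x ∈ (f0.comp (Substructure.inclusion hBA)).toHom.range := by
          rw [hB]; exact ⟨hxA, hxC⟩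
        obtain ⟨⟨b, hb⟩, rfl⟩ := this
        have k0 : f0.equivRange.symm ⟨_, hxA⟩ = ⟨b, hBA hb⟩ := e0 ⟨b, hBA hb⟩
        have k1 : f1.equivRange.symm ⟨_, hxC⟩ = ⟨b, hBC hb⟩ := by
          rw [← e1 ⟨b, hBC hb⟩]; congr 2; exact hc' b hb
        change f' (f0.equivRange.symm ⟨_, hxA⟩) = g' (f1.equivRange.symm ⟨_, hxC⟩)
        rw [k0, k1]
        exact Subtype.ext (hfg b hb))
    refine ⟨E.subtype.toHom.comp (h.comp ((Substructure.topEquiv (L := L) (M := D0)).symm.toHom.comp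
      δ.equivRange.symm.toHom)), ?_, ?_⟩
    · intro x hx hx'
      have k : δ.equivRange.symm ⟨μ x, hx'⟩ = f0 ⟨x, hx⟩ := by
        rw [← ed (f0 ⟨x, hx⟩)]; congr 2; exact hμ' x hx
      change E.subtype (h ⟨δ.equivRange.symm ⟨μ x, hx'⟩, trivial⟩) = _
      have := hh0 (f0 ⟨x, hx⟩) ⟨_, rfl⟩ trivial
      simp only [k]
      refine (congrArg (Subtype.val) this).trans ?_
      change ((f' (f0.equivRange.symm ⟨f0 ⟨x, hx⟩, _⟩) : E) : M) = _
      rw [e0]; rfl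
    · intro x hx hx'
      have k : δ.equivRange.symm ⟨ν x, hx'⟩ = f1 ⟨x, hx⟩ := by
        rw [← ed (f1 ⟨x, hx⟩)]; congr 2; exact hν' x hx
      change E.subtype (h ⟨δ.equivRange.symm ⟨ν x, hx'⟩, trivial⟩) = _
      have := hh1 (f1 ⟨x, hx⟩) ⟨_, rfl⟩ trivial
      simp only [k]
      refine (congrArg (Subtype.val) this).trans ?_
      change ((g' (f1.equivRange.symm ⟨f1 ⟨x, hx⟩, _⟩) : E) : M) = _
      rw [e1]; rfl

theorem extPair_of_local (hHom : L.IsUltrahomogeneous M)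
    (hloc : ∀ T : L.Substructure Q, T.FG → Nonempty (T ↪[L] M)) : L.IsExtensionPair Q M := by
  rw [isExtensionPair_iff_exists_embedding_closure_singleton_sup]
  intro S hS f m
  have := hloc (closure L {m} ⊔ S) ((fg_closure (Set.finite_singleton m)).sup hS)
  exact hHom.extend_embedding (S.fg_iff_structure_fg.1 hS) f (Substructure.inclusion le_sup_right)

theorem fgEquiv_of_local 
    (hloc : ∀ T : L.Substructure Q, T.FG → Nonempty (T ↪[L] M)) : Nonempty (L.FGEquiv Q M) := by
  obtain ⟨e⟩ := hloc ⊥ fg_bot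
  exact ⟨⟨⟨⊥, e.toHom.range, e.equivRange⟩, fg_bot⟩⟩

theorem factor (f : P ↪[L] Q) (k : M ↪[L] Q) (h : ∀ x, f x ∈ k.toHom.range) :
    ∃ g : P ↪[L] M, ∀ x, k (g x) = f x := by
  refine ⟨k.equivRange.symm.toEmbedding.comp (f.codRestrict k.toHom.range h), fun x => ?_⟩
  have : k.equivRange (k.equivRange.symm ⟨f x, h x⟩) = ⟨f x, h x⟩ := Equiv.apply_symm_apply _ _
  exact congrArg Subtype.val this

end basics

section step
variable (L : FirstOrder.Language.{u, v}) (M P : Type w) [L.Structure M] [L.Structure P]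

open Substructure Structure

/-- indices -/
def Idx : Type w := {l : List (P × M) // ∃ j : P ↪[L] M, ∀ p ∈ l, j p.1 = p.2}

/-- compatible assignments -/
structure Asg : Type w where
  s : P →[L] M
  t : Idx L M P → (M →[L] M)
  compat : ∀ i : Idx L M P, ∀ p ∈ i.1, t i p.2 = s p.1

/-- power of `M` -/
def Pw : Type w := Asg L M P → M

instance : L.Structure (Pw L M P) where
  funMap f x := fun σ => funMap f fun k => x k σ
  RelMap r x := ∀ σ, RelMap r fun k => x k σ

variable {L M P}

/-- action on indices -/
def Idx.act (g : P ≃[L] P) (i : Idx L M P) : Idx L M P :=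
  ⟨i.1.map fun p => (g p.1, p.2), by
    obtain ⟨l, j, hj⟩ := i
    refine ⟨j.comp g.symm.toEmbedding, ?_⟩
    intro p hp
    obtain ⟨q, hq, rfl⟩ := List.mem_map.1 hp
    have := hj q hq
    simpa using this⟩

theorem Idx.act_act (g h : P ≃[L] P) (i : Idx L M P) : (i.act h).act g = i.act (g.comp h) := by
  apply Subtype.ext
  simp [Idx.act, Function.comp_def]

theorem Idx.act_refl (i : Idx L M P) : i.act (FirstOrder.Language.Equiv.refl L P) = i := by
  apply Subtype.ext
  simp [Idx.act]

/-- action on assignments -/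
def Asg.act (g : P ≃[L] P) (σ : Asg L M P) : Asg L M P :=
  ⟨σ.s.comp g.toHom, fun i => σ.t (i.act g), by
    intro i p hp
    exact σ.compat (i.act g) (g p.1, p.2) (List.mem_map.2 ⟨p, hp, rfl⟩)⟩

theorem Asg.act_act (g h : P ≃[L] P) (σ : Asg L M P) : (σ.act g).act h = σ.act (g.comp h) := by
  simp only [Asg.act, Idx.act_act]
  rfl

theorem Asg.act_refl (σ : Asg L M P) : σ.act (FirstOrder.Language.Equiv.refl L P) = σ := by
  simp only [Asg.act, Idx.act_refl]
  rfl

/-- action on the power -/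
def Pw.act (g : P ≃[L] P) : Pw L M P ≃[L] Pw L M P where
  toFun F := fun σ => F (σ.act g)
  invFun F := fun σ => F (σ.act g.symm)
  left_inv F := by
    funext σ
    change F ((σ.act g.symm).act g) = F σ
    rw [Asg.act_act, show g.symm.comp g = FirstOrder.Language.Equiv.refl L P by ext; simp, Asg.act_refl]
  right_inv F := by
    funext σ
    change F ((σ.act g).act g.symm) = F σ
    rw [Asg.act_act, show g.comp g.symm = FirstOrder.Language.Equiv.refl L P by ext; simp, Asg.act_refl]
  map_fun' f x := rfl
  map_rel' r x := by
    constructor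
    · intro h σ
      have := h (σ.act g.symm)
      change RelMap r (fun k => x k ((σ.act g.symm).act g)) at this
      rwa [Asg.act_act, show g.symm.comp g = FirstOrder.Language.Equiv.refl L P by ext; simp, Asg.act_refl] at this
    · intro h σ
      exact h _

theorem Pw.act_comp (g h : P ≃[L] P) (F : Pw L M P) : Pw.act (g.comp h) F = Pw.act g (Pw.act h F) := by
  funext σ
  change F _ = F _
  rw [Asg.act_act]

/-- evaluation -/
def evP : P →[L] Pw L M P where
  toFun x := fun σ => σ.s x
  map_fun' f x := funext fun σ => σ.s.map_fun f x
  map_rel' r x h := fun σ => σ.s.map_rel r x h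

/-- evaluation -/
def evI (i : Idx L M P) : M →[L] Pw L M P where
  toFun x := fun σ => σ.t i x
  map_fun' f x := funext fun σ => (σ.t i).map_fun f x
  map_rel' r x h := fun σ => (σ.t i).map_rel r x h

/-- evaluation at a point -/
def pr (σ : Asg L M P) : Pw L M P →[L] M where
  toFun F := F σ
  map_fun' _ _ := rfl
  map_rel' _ _ h := h σ

theorem act_evP (g : P ≃[L] P) (x : P) : Pw.act g (evP (M := M) x) = evP (g x) := rfl
theorem act_evI (g : P ≃[L] P) (i : Idx L M P) (x : M) :
    Pw.act g (evI i x) = evI (i.act g) x := rfl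

theorem key (hHom : L.IsUltrahomogeneous M) (hFA : HasFreeAmalgamsInAge L M)
    (hP : Nonempty (P ↪[L] M)) (a : Finset P) (c : Finset M) (J : Finset (Idx L M P)) :
    (∀ i ∈ J, ∀ p ∈ i.1, p.1 ∈ a ∧ p.2 ∈ c) →
    ∃ (s : P ↪[L] M) (t : Idx L M P → (M ≃[L] M)) (_ : ∀ i, ∀ p ∈ i.1, t i p.2 = s p.1)
      (D : L.Substructure M), D.FG ∧ (∀ x ∈ a, s x ∈ D) ∧ (∀ i ∈ J, ∀ m ∈ c, t i m ∈ D) ∧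
      ∀ σ : Asg L M P, ∃ h : D →[L] M, (∀ x ∈ a, ∀ hx, h ⟨s x, hx⟩ = σ.s x) ∧
        ∀ i ∈ J, ∀ m ∈ c, ∀ hx, h ⟨t i m, hx⟩ = σ.t i m := by
  classical
  induction J using Finset.induction_on with
  | empty =>
    intro _
    obtain ⟨j⟩ := hP
    have hT : ∀ i : Idx L M P, ∃ t : M ≃[L] M, ∀ p ∈ i.1, t p.2 = j p.1 := by
      rintro ⟨l, j', hj'⟩
      let T : L.Substructure P := closure L (l.map Prod.fst).toFinset
      have hTfg : T.FG := ⟨_, rfl⟩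
      have : Nonempty (M ↪[L] M) := ⟨Embedding.refl L M⟩
      let k : T ↪[L] M := j'.comp T.subtype
      have hkfg : k.toHom.range.FG := (T.fg_iff_structure_fg.1 hTfg).range _
      obtain ⟨t, ht⟩ := hHom k.toHom.range hkfg ((j.comp T.subtype).comp k.equivRange.symm.toEmbedding)
      refine ⟨t, fun p hp => ?_⟩
      have hpT : p.1 ∈ T := subset_closure (by simpa using ⟨p.2, hp⟩)
      have h1 := DFunLike.congr_fun ht (k.equivRange ⟨p.1, hpT⟩)
      have h2 : k.equivRange.symm (k.equivRange ⟨p.1, hpT⟩) = ⟨p.1, hpT⟩ :=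
        Equiv.symm_apply_apply _ _
      have h3 : j p.1 = t (j' p.1) := by
        have h4 : ((j.comp T.subtype).comp k.equivRange.symm.toEmbedding) (k.equivRange ⟨p.1, hpT⟩) = j p.1 := by
          change j (k.equivRange.symm (k.equivRange ⟨p.1, hpT⟩) : T) = _
          rw [h2]
        rw [← h4, h1]; rfl
      rw [h3, hj' p hp]
    choose t ht using hT
    let A : L.Substructure P := closure L (a : Set P)
    have hA : A.FG := ⟨_, rfl⟩
    let k : A ↪[L] M := j.comp A.subtype
    refine ⟨j, t, ht, k.toHom.range, (A.fg_iff_structure_fg.1 hA).range _, ?_, by simp, ?_⟩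
    · intro x hx
      exact ⟨⟨x, subset_closure hx⟩, rfl⟩
    · intro σ
      refine ⟨(σ.s.comp A.subtype.toHom).comp k.equivRange.symm.toHom, ?_, by simp⟩
      intro x hx hx'
      have h2 : k.equivRange.symm ⟨j x, hx'⟩ = ⟨x, subset_closure hx⟩ :=
        k.equivRange.symm_apply_apply ⟨x, subset_closure hx⟩
      change σ.s (k.equivRange.symm ⟨j x, hx'⟩ : A) = _
      rw [h2]
  | insert i J hi ih =>
    intro hgood
    obtain ⟨s, t, hc, D, hD, hsD, htD, hσ⟩ := ih fun k hk => hgood k (Finset.mem_insert_of_mem hk)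
    have hgi := hgood i (Finset.mem_insert_self _ _)
    let C : L.Substructure M := closure L (t i '' (c : Set M))
    have hC : C.FG := fg_closure (c.finite_toSet.image _)
    let b : Set M := {x | ∃ p ∈ i.1, t i p.2 = x}
    have hbD : closure L b ≤ D := by
      rw [closure_le]
      rintro x ⟨p, hp, rfl⟩
      rw [hc i p hp]
      exact hsD _ (hgi p hp).1
    have hbC : closure L b ≤ C := by
      rw [closure_le]
      rintro x ⟨p, hp, rfl⟩
      exact subset_closure ⟨p.2, (hgi p hp).2, rfl⟩
    obtain ⟨μ, ν, D', hD', hμν, hμD, hνD, hext⟩ := fa hHom hFA D C (closure L b) hD hC hbD hbC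
    have hmC : ∀ m ∈ c, t i m ∈ C := fun m hm => subset_closure ⟨m, hm, rfl⟩
    refine ⟨μ.toEmbedding.comp s, fun k => if k = i then ν.comp (t i) else μ.comp (t k), ?_, D',
      hD', ?_, ?_, ?_⟩
    · intro k p hp
      by_cases hk : k = i
      · subst hk
        simp only [if_true]
        change ν (t k p.2) = μ (s p.1)
        rw [← hc k p hp]
        exact (hμν _ (subset_closure ⟨p, hp, rfl⟩)).symm
      · simp only [if_neg hk]
        change μ (t k p.2) = μ (s p.1)
        rw [hc k p hp]
    · intro x hx
      exact hμD _ (hsD x hx)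
    · intro k hk m hm
      by_cases hki : k = i
      · subst hki
        simp only [if_true]
        exact hνD _ (hmC m hm)
      · simp only [if_neg hki]
        exact hμD _ (htD k (Finset.mem_of_mem_insert_of_ne hk hki) m hm)
    · intro σ
      obtain ⟨h, h1, h2⟩ := hσ σ
      let g : C →[L] M := ((σ.t i).comp (t i).symm.toHom).comp C.subtype.toHom
      have hg : ∀ m (hm : t i m ∈ C), g ⟨t i m, hm⟩ = σ.t i m := by
        intro m hm
        change σ.t i ((t i).symm (t i m)) = _
        rw [FirstOrder.Language.Equiv.symm_apply_apply]
      obtain ⟨h', h1', h2'⟩ := hext h g (by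
        intro x hx
        obtain ⟨_, _, h⟩ := agree_closure h g b (by
          rintro x ⟨p, hp, rfl⟩
          have hx1 : t i p.2 ∈ D := hbD (subset_closure ⟨p, hp, rfl⟩)
          have hx2 : t i p.2 ∈ C := hbC (subset_closure ⟨p, hp, rfl⟩)
          refine ⟨hx1, hx2, ?_⟩
          rw [hg]
          have := h1 p.1 (hgi p hp).1 (by rw [← hc i p hp]; exact hx1)
          rw [σ.compat i p hp, ← this]
          congr 2
          exact hc i p hp) hx
        exact h)
      refine ⟨h', ?_, ?_⟩
      · intro x hx hx'
        exact (h1' (s x) (hsD x hx) hx').trans (h1 x hx _)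
      · intro k hk m hm
        by_cases hki : k = i
        · subst hki
          simp only [if_true]
          intro hx
          exact (h2' (t k m) (hmC m hm) hx).trans (hg m _)
        · simp only [if_neg hki]
          intro hx
          have hkJ := Finset.mem_of_mem_insert_of_ne hk hki
          exact (h1' (t k m) (htD k hkJ m hm) hx).trans (h2 k hkJ m hm _)


/-- generators -/
def gens (a : Finset P) (c : Finset M) (J : Finset (Idx L M P)) : Set (Pw L M P) :=
  {F | (∃ x ∈ a, F = evP x) ∨ ∃ i ∈ J, ∃ m ∈ c, F = evI i m}

theorem gens_mono {a a' : Finset P} {c c' : Finset M} {J J' : Finset (Idx L M P)}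
    (ha : a ⊆ a') (hc : c ⊆ c') (hJ : J ⊆ J') : gens a c J ⊆ gens a' c' J' := by
  rintro F (⟨x, hx, rfl⟩ | ⟨i, hi, m, hm, rfl⟩)
  · exact Or.inl ⟨x, ha hx, rfl⟩
  · exact Or.inr ⟨i, hJ hi, m, hc hm, rfl⟩

theorem emb_gens (hHom : L.IsUltrahomogeneous M) (hFA : HasFreeAmalgamsInAge L M)
    (hP : Nonempty (P ↪[L] M)) (a : Finset P) (c : Finset M) (J : Finset (Idx L M P)) :
    Nonempty (closure L (gens a c J) ↪[L] M) := by
  classical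
  let a' : Finset P := a ∪ J.biUnion fun i => (i.1.map Prod.fst).toFinset
  let c' : Finset M := c ∪ J.biUnion fun i => (i.1.map Prod.snd).toFinset
  have hle : closure L (gens a c J) ≤ closure L (gens a' c' J) :=
    (Substructure.closure L).monotone (gens_mono Finset.subset_union_left Finset.subset_union_left subset_rfl)
  obtain ⟨s, t, hst, D, -, hsD, htD, hσ⟩ := key hHom hFA hP a' c' J (by
    intro i hi p hp
    constructor
    · exact Finset.mem_union_right _ (Finset.mem_biUnion.2 ⟨i, hi, by
        simpa using ⟨p.2, hp⟩⟩)
    · exact Finset.mem_union_right _ (Finset.mem_biUnion.2 ⟨i, hi, by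
        simpa using ⟨p.1, hp⟩⟩))
  let σ0 : Asg L M P := ⟨s.toHom, fun i => (t i).toHom, hst⟩
  have hmain : ∀ σ : Asg L M P, ∃ h : D →[L] M, ∀ F ∈ closure L (gens a' c' J),
      ∃ hx : F σ0 ∈ D, h ⟨F σ0, hx⟩ = F σ := by
    intro σ
    obtain ⟨h, h1, h2⟩ := hσ σ
    refine ⟨h, fun F hF => ?_⟩
    refine closure_induction (p := fun F : Pw L M P => ∃ hx : F σ0 ∈ D, h ⟨F σ0, hx⟩ = F σ)
      hF ?_ ?_
    · rintro F (⟨x, hx, rfl⟩ | ⟨i, hi, m, hm, rfl⟩)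
      · exact ⟨hsD x hx, h1 x hx _⟩
      · exact ⟨htD i hi m hm, h2 i hi m hm _⟩
    · intro n f y hy
      have hy' : ∀ k, ∃ hx : y k σ0 ∈ D, h ⟨y k σ0, hx⟩ = y k σ := hy
      choose hA he using hy'
      refine ⟨D.fun_mem f _ hA, ?_⟩
      have h1 := h.map_fun f (fun k => ⟨y k σ0, hA k⟩)
      have h3 : (h ∘ fun k => (⟨y k σ0, hA k⟩ : D)) = fun k => y k σ := funext he
      rw [h3] at h1
      exact h1
  let e : closure L (gens a' c' J) ↪[L] M :=
    { toFun := fun F => F.1 σ0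
      inj' := by
        intro F G hFG
        apply Subtype.ext
        funext σ
        obtain ⟨h, hh⟩ := hmain σ
        obtain ⟨_, h1⟩ := hh F.1 F.2
        obtain ⟨_, h2⟩ := hh G.1 G.2
        rw [← h1, ← h2]
        congr 2
      map_fun' := fun _ _ => rfl
      map_rel' := by
        intro n r x
        constructor
        · intro hr σ
          obtain ⟨h, hh⟩ := hmain σ
          have hh' : ∀ k, ∃ hx : (x k).1 σ0 ∈ D, h ⟨(x k).1 σ0, hx⟩ = (x k).1 σ :=
            fun k => hh (x k).1 (x k).2
          choose hA he using hh'
          have h1 := h.map_rel r (fun k => ⟨(x k).1 σ0, hA k⟩) hr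
          have h3 : (h ∘ fun k => (⟨(x k).1 σ0, hA k⟩ : D)) = fun k => (x k).1 σ := funext he
          rw [h3] at h1
          exact h1
        · intro hr
          exact hr σ0 }
  exact ⟨e.comp (Substructure.inclusion hle)⟩

variable (L M P) in
/-- the next structure -/
def Nx : L.Substructure (Pw L M P) :=
  closure L (Set.range (evP (M := M)) ∪ ⋃ i, Set.range (evI i))

theorem evP_mem (x : P) : evP x ∈ Nx L M P := subset_closure (Or.inl ⟨x, rfl⟩)
theorem evI_mem (i : Idx L M P) (x : M) : evI i x ∈ Nx L M P :=
  subset_closure (Or.inr (Set.mem_iUnion.2 ⟨i, x, rfl⟩))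

theorem act_mem (g : P ≃[L] P) (F : Pw L M P) (hF : F ∈ Nx L M P) : Pw.act g F ∈ Nx L M P := by
  have : Nx L M P ≤ (Nx L M P).comap (Pw.act g).toHom := by
    conv_lhs => rw [Nx]
    rw [closure_le]
    rintro F (⟨x, rfl⟩ | hF)
    · exact evP_mem (g x)
    · obtain ⟨i, x, rfl⟩ := Set.mem_iUnion.1 hF
      exact evI_mem (i.act g) x
  exact this hF

/-- action on the next structure -/
def nxAct (g : P ≃[L] P) : Nx L M P ≃[L] Nx L M P where
  toFun F := ⟨Pw.act g F.1, act_mem g F.1 F.2⟩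
  invFun F := ⟨Pw.act g.symm F.1, act_mem g.symm F.1 F.2⟩
  left_inv F := Subtype.ext ((Pw.act (M := M) g).left_inv F.1)
  right_inv F := Subtype.ext ((Pw.act (M := M) g).right_inv F.1)
  map_fun' _ _ := rfl
  map_rel' r x := (Pw.act (M := M) g).map_rel r fun k => (x k).1

theorem nxAct_comp (g h : P ≃[L] P) :
    nxAct (M := M) (g.comp h) = (nxAct g).comp (nxAct h) := by
  ext F
  exact Pw.act_comp g h F.1

theorem nx_local (hHom : L.IsUltrahomogeneous M) (hFA : HasFreeAmalgamsInAge L M)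
    (hP : Nonempty (P ↪[L] M)) (T : L.Substructure (Nx L M P)) (hT : T.FG) :
    Nonempty (T ↪[L] M) := by
  classical
  let U : (Finset P × Finset M × Finset (Idx L M P)) → L.Substructure (Pw L M P) :=
    fun τ => closure L (gens τ.1 τ.2.1 τ.2.2)
  have hmono : Monotone U := fun τ τ' h =>
    (Substructure.closure L).monotone (gens_mono h.1 h.2.1 h.2.2)
  have hdir : Directed (· ≤ ·) U := hmono.directed_le
  have hle : Nx L M P ≤ ⨆ τ, U τ := by
    rw [Nx, closure_le]
    rintro F (⟨x, rfl⟩ | hF)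
    · exact (le_iSup U ({x}, ∅, ∅)) (subset_closure (Or.inl ⟨x, by simp, rfl⟩))
    · obtain ⟨i, x, rfl⟩ := Set.mem_iUnion.1 hF
      exact (le_iSup U (∅, {x}, {i})) (subset_closure (Or.inr ⟨i, by simp, x, by simp, rfl⟩))
  obtain ⟨b, hb⟩ := hT
  have hex : ∀ x : b, ∃ τ, x.1.1 ∈ U τ := fun x =>
    (mem_iSup_of_directed hdir).1 (hle x.1.2)
  choose τ hτ using hex
  obtain ⟨τ0, hτ0⟩ := Directed.finite_le hdir τ
  have hTU : T ≤ (U τ0).comap (Nx L M P).subtype.toHom := by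
    rw [← hb, closure_le]
    intro x hx
    exact hτ0 ⟨x, hx⟩ (hτ ⟨x, hx⟩)
  obtain ⟨e⟩ := emb_gens hHom hFA hP τ0.1 τ0.2.1 τ0.2.2
  exact ⟨e.comp (((Nx L M P).subtype.comp T.subtype).codRestrict (U τ0) fun x => hTU x.2)⟩

theorem nx_countable [Countable L.Symbols] [Countable M] [Countable P] :
    Countable (Nx L M P) := by
  have : Countable (Idx L M P) := inferInstanceAs (Countable {l : List (P × M) // _})
  have : Countable (Σ l, L.Functions l) :=
    (Sum.inl_injective (β := Σ l, L.Relations l)).countable (β := L.Symbols)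
  exact Set.Countable.substructure_closure L
    ((Set.countable_range _).union (Set.countable_iUnion fun i => Set.countable_range _))

theorem nx_emb [Countable L.Symbols] [Countable M] [Countable P]
    (hHom : L.IsUltrahomogeneous M) (hFA : HasFreeAmalgamsInAge L M)
    (hP : Nonempty (P ↪[L] M)) : Nonempty (Nx L M P ↪[L] M) := by
  have := nx_countable (L := L) (M := M) (P := P)
  obtain ⟨g⟩ := fgEquiv_of_local (nx_local hHom hFA hP)
  obtain ⟨f, -⟩ := embedding_from_cg Structure.cg_of_countable g
    (extPair_of_local hHom (nx_local hHom hFA hP))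
  exact ⟨f⟩

theorem good_asg (hHom : L.IsUltrahomogeneous M) (hFA : HasFreeAmalgamsInAge L M)
    (hP : Nonempty (P ↪[L] M)) : ∃ (σ : Asg L M P) (s : P ↪[L] M)
      (t : Idx L M P → (M ≃[L] M)), σ.s = s.toHom ∧ ∀ i, σ.t i = (t i).toHom := by
  obtain ⟨s, t, h, -⟩ := key hHom hFA hP ∅ ∅ ∅ (by simp)
  exact ⟨⟨s.toHom, fun i => (t i).toHom, h⟩, s, t, rfl, fun _ => rfl⟩

theorem nx_incl (hHom : L.IsUltrahomogeneous M) (hFA : HasFreeAmalgamsInAge L M)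
    (hP : Nonempty (P ↪[L] M)) :
    ∃ ι : P ↪[L] Nx L M P, ∀ x, ι x = ⟨evP x, evP_mem x⟩ := by
  obtain ⟨σ, s, t, hs, ht⟩ := good_asg hHom hFA hP
  refine ⟨{ toFun := fun x => ⟨evP x, evP_mem x⟩, inj' := ?_, map_fun' := ?_, map_rel' := ?_ },
    fun _ => rfl⟩
  · intro x y hxy
    have : σ.s x = σ.s y := congrFun (congrArg Subtype.val hxy) σ
    rw [hs] at this
    exact s.injective this
  · intro n f x
    exact Subtype.ext (evP.map_fun f x)
  · intro n r x
    constructor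
    · intro h
      have : RelMap r (σ.s ∘ x) := h σ
      rw [hs] at this
      exact (s.map_rel r x).1 this
    · intro h
      exact evP.map_rel r x h

theorem nx_inclI (hHom : L.IsUltrahomogeneous M) (hFA : HasFreeAmalgamsInAge L M)
    (hP : Nonempty (P ↪[L] M)) (i : Idx L M P) :
    ∃ ι : M ↪[L] Nx L M P, ∀ x, ι x = ⟨evI i x, evI_mem i x⟩ := by
  obtain ⟨σ, s, t, hs, ht⟩ := good_asg hHom hFA hP
  refine ⟨{ toFun := fun x => ⟨evI i x, evI_mem i x⟩, inj' := ?_, map_fun' := ?_, map_rel' := ?_ },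
    fun _ => rfl⟩
  · intro x y hxy
    have : σ.t i x = σ.t i y := congrFun (congrArg Subtype.val hxy) σ
    rw [ht] at this
    exact (t i).injective this
  · intro n f x
    exact Subtype.ext ((evI i).map_fun f x)
  · intro n r x
    constructor
    · intro h
      have : RelMap r (σ.t i ∘ x) := h σ
      rw [ht] at this
      exact ((t i).map_rel r x).1 this
    · intro h
      exact (evI i).map_rel r x h

theorem nx_rich (hHom : L.IsUltrahomogeneous M) (hFA : HasFreeAmalgamsInAge L M)
    (j : P ↪[L] M) (T : L.Substructure P) (hT : T.FG) :
    ∃ e : M ↪[L] Nx L M P, ∀ x ∈ T, e (j x) = ⟨evP x, evP_mem x⟩ := by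
  obtain ⟨b, rfl⟩ := hT
  obtain ⟨ι, hι⟩ := nx_incl hHom hFA ⟨j⟩
  let i : Idx L M P := ⟨b.toList.map fun x => (x, j x), j, by
    intro p hp
    obtain ⟨x, _, rfl⟩ := List.mem_map.1 hp
    rfl⟩
  obtain ⟨e, he⟩ := nx_inclI hHom hFA ⟨j⟩ i
  refine ⟨e, fun x hx => ?_⟩
  rw [← hι]
  refine Hom.eqOn_closure (f := e.toHom.comp j.toHom) (g := ι.toHom) (s := b) ?_ hx
  intro x hx
  change e (j x) = ι x
  rw [he, hι]
  apply Subtype.ext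
  funext σ
  exact σ.compat i (x, j x) (List.mem_map.2 ⟨x, by simpa using hx, rfl⟩)

end step

section tower
variable {L : FirstOrder.Language.{u, v}} {M : Type w} [L.Structure M]

open Substructure Structure

variable (M) in
/-- stages of the tower -/
structure Stage (N : L.Substructure M) where
  P : Type w
  str : L.Structure P
  cnt : Countable P
  emb : Nonempty (P ↪[L] M)
  act : (N ≃[L] N) → (P ≃[L] P)
  act_comp : ∀ e f, act (e.comp f) = (act e).comp (act f)

attribute [instance] Stage.str Stage.cnt

variable [Countable L.Symbols] [Countable M]

/-- first stage -/
def Stage.zero (N : L.Substructure M) : Stage M N :=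
  ⟨N, inferInstance, inferInstance, ⟨N.subtype⟩, id, fun _ _ => rfl⟩

/-- next stage -/
def Stage.next {N : L.Substructure M} (hHom : L.IsUltrahomogeneous M)
    (hFA : HasFreeAmalgamsInAge L M) (X : Stage M N) : Stage M N :=
  ⟨Nx L M X.P, inferInstance, nx_countable, nx_emb hHom hFA X.emb, fun e => nxAct (X.act e),
    fun e f => by rw [X.act_comp, nxAct_comp]⟩

/-- the tower -/
def tower (N : L.Substructure M) (hHom : L.IsUltrahomogeneous M)
    (hFA : HasFreeAmalgamsInAge L M) : ℕ → Stage M N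
  | 0 => Stage.zero N
  | n + 1 => (tower N hHom hFA n).next hHom hFA

theorem tower_step (N : L.Substructure M) (hHom : L.IsUltrahomogeneous M)
    (hFA : HasFreeAmalgamsInAge L M) (n : ℕ) :
    ∃ ι : (tower N hHom hFA n).P ↪[L] (tower N hHom hFA (n + 1)).P,
      (∀ e x, ι ((tower N hHom hFA n).act e x) = (tower N hHom hFA (n + 1)).act e (ι x)) ∧
      ∀ (j : (tower N hHom hFA n).P ↪[L] M) (T : L.Substructure (tower N hHom hFA n).P), T.FG →
        ∃ e : M ↪[L] (tower N hHom hFA (n + 1)).P, ∀ x ∈ T, e (j x) = ι x := by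
  obtain ⟨ι, hι⟩ := nx_incl hHom hFA (tower N hHom hFA n).emb
  refine ⟨ι, ?_, ?_⟩
  · intro e x
    have h : ι ((tower N hHom hFA n).act e x) = nxAct ((tower N hHom hFA n).act e) (ι x) := by
      rw [hι, hι]
      rfl
    exact h
  · intro j T hT
    obtain ⟨e, he⟩ := nx_rich hHom hFA j T hT
    exact ⟨e, fun x hx => (he x hx).trans (hι x).symm⟩

theorem main (N : L.Substructure M) (hHom : L.IsUltrahomogeneous M)
    (hFA : HasFreeAmalgamsInAge L M) : ∃ Φ : (N ≃[L] N) → (M ≃[L] M),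
      Function.Injective Φ ∧ ∀ e f : N ≃[L] N, Φ (e.comp f) = (Φ e).comp (Φ f) := by
  choose ι hact hrich using tower_step N hHom hFA
  let G : ℕ → Type w := fun n => (tower N hHom hFA n).P
  let k : ∀ i j, i ≤ j → G i ↪[L] G j := DirectedSystem.natLERec (G' := G) ι
  let Q := FirstOrder.Language.DirectLimit G k
  let o : ∀ n, G n ↪[L] Q := fun n => FirstOrder.Language.DirectLimit.of L ℕ G k n
  have hk0 : ∀ n x, k n n le_rfl x = x := by
    intro n x
    exact (congrFun (DirectedSystem.coe_natLERec (G' := G) ι n n le_rfl) x).trans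
      (Nat.leRecOn_self _)
  have hkS : ∀ i j (h : i ≤ j) x, k i (j + 1) (Nat.le_succ_of_le h) x = ι j (k i j h x) := by
    intro i j h x
    have h1 := congrFun (DirectedSystem.coe_natLERec (G' := G) ι i (j + 1) (Nat.le_succ_of_le h)) x
    have h2 := congrFun (DirectedSystem.coe_natLERec (G' := G) ι i j h) x
    refine h1.trans ((Nat.leRecOn_succ h _).trans ?_)
    exact congrArg (ι j) h2.symm
  have hk1 : ∀ n x, k n (n + 1) (Nat.le_succ n) x = ι n x := by
    intro n x
    rw [hkS n n le_rfl, hk0]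
  have ho : ∀ n x, o (n + 1) (ι n x) = o n x := by
    intro n x
    rw [← hk1]
    exact FirstOrder.Language.DirectLimit.of_f
  have hcomm : ∀ (e : N ≃[L] N) i j (hij : i ≤ j) (x : G i),
      (tower N hHom hFA j).act e (k i j hij x) = k i j hij ((tower N hHom hFA i).act e x) := by
    intro e i j hij x
    induction j, hij using Nat.le_induction with
    | base => rw [hk0, hk0]
    | succ j hij ih =>
      rw [hkS i j hij, hkS i j hij, ← ih]
      exact (hact j e _).symm
  let A : (N ≃[L] N) → (Q ≃[L] Q) := fun e =>
    FirstOrder.Language.DirectLimit.equiv_lift L ℕ G k G k (fun n => (tower N hHom hFA n).act e) (hcomm e)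
  have hA : ∀ e n x, A e (o n x) = o n ((tower N hHom hFA n).act e x) := fun e n x => rfl
  have hAcomp : ∀ e f q, A (e.comp f) q = A e (A f q) := by
    intro e f q
    obtain ⟨n, x, rfl⟩ := FirstOrder.Language.DirectLimit.exists_of q
    have h1 := hA (e.comp f) n x
    rw [(tower N hHom hFA n).act_comp] at h1
    exact h1
  have hAinj : ∀ e f, A e = A f → e = f := by
    intro e f hef
    ext x
    have h1 := hA e 0 x
    rw [hef] at h1
    have h2 := hA f 0 x
    exact congrArg Subtype.val ((o 0).injective (h1.symm.trans h2))
  have hrange : ∀ S : L.Substructure Q, S.FG → ∃ n, ∀ x ∈ S, x ∈ (o n).toHom.range := by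
    intro S hS
    obtain ⟨n, T, rfl⟩ := FirstOrder.Language.DirectLimit.exists_fg_substructure_in_Sigma S hS
    refine ⟨n, ?_⟩
    rintro x ⟨y, _, rfl⟩
    exact ⟨y, rfl⟩
  have hloc : ∀ T : L.Substructure Q, T.FG → Nonempty (T ↪[L] M) := by
    intro T hT
    obtain ⟨n, hn⟩ := hrange T hT
    obtain ⟨g, _⟩ := factor T.subtype (o n) (fun x => hn x x.2)
    obtain ⟨j⟩ := (tower N hHom hFA n).emb
    exact ⟨j.comp g⟩
  have hext1 := extPair_of_local hHom hloc
  have hext2 : L.IsExtensionPair M Q := by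
    rw [isExtensionPair_iff_exists_embedding_closure_singleton_sup]
    intro S hS f m
    have hS' := S.fg_iff_structure_fg.1 hS
    obtain ⟨n, hn⟩ := hrange f.toHom.range (hS'.range _)
    obtain ⟨g, hg⟩ := factor f (o n) (fun x => hn _ ⟨x, rfl⟩)
    have := (tower N hHom hFA n).emb
    obtain ⟨j, hj⟩ := hHom.extend_embedding hS' S.subtype g
    obtain ⟨e, he⟩ := hrich n j g.toHom.range (hS'.range _)
    refine ⟨((o (n + 1)).comp e).comp (Substructure.subtype _), ?_⟩
    ext x
    have h1 : (x : M) = j (g x) := DFunLike.congr_fun hj x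
    change f x = o (n + 1) (e (x : M))
    rw [h1, he (g x) ⟨x, rfl⟩, ho, hg]
  obtain ⟨g⟩ := fgEquiv_of_local hloc
  have hcg : ∀ n, Structure.CG L (G n) := fun n => Structure.cg_of_countable
  obtain ⟨θ, -⟩ := equiv_between_cg (FirstOrder.Language.DirectLimit.cg k hcg) Structure.cg_of_countable g hext1 hext2
  refine ⟨fun e => θ.comp ((A e).comp θ.symm), ?_, ?_⟩
  · intro e f hef
    apply hAinj
    ext q
    have := DFunLike.congr_fun hef (θ q)
    change θ (A e (θ.symm (θ q))) = θ (A f (θ.symm (θ q))) at this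
    rw [FirstOrder.Language.Equiv.symm_apply_apply] at this
    exact θ.injective this
  · intro e f
    ext x
    change θ (A (e.comp f) (θ.symm x)) = θ (A e (θ.symm (θ (A f (θ.symm x)))))
    rw [FirstOrder.Language.Equiv.symm_apply_apply, hAcomp]

end tower

end AutUniv

/-- if `M₀` is a countable ultrahomogeneous structure over a countable
language whose age has free amalgamation, then `Aut(M₀)` is universal for the
automorphism groups of substructures of `M₀`: for every substructure `N` of `M₀`
there is an injective, composition-preserving (i.e. group-) homomorphism
from `Aut(N)` into `Aut(M₀)`. -/
theorem aut_universal_of_freeAmalgamation (L : FirstOrder.Language.{u, v})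
    [Countable L.Symbols] (M₀ : Type w) [L.Structure M₀] [Countable M₀]
    (hHom : L.IsUltrahomogeneous M₀)
    (hFA : HasFreeAmalgamsInAge L M₀) :
    ∀ N : L.Substructure M₀, ∃ Φ : (N ≃[L] N) → (M₀ ≃[L] M₀),
      Function.Injective Φ ∧ ∀ e f : N ≃[L] N, Φ (e.comp f) = (Φ e).comp (Φ f) := by
  exact fun N => AutUniv.main N hHom hFA
end

section
/- Let L be a first-order language and T an L-theory each of whose sentences is universal, i.e., of the form ∀x₁⋯∀x_n ψ with ψ quantifier-free. Let J be the class of all models of T, and assume that every substructure of a finitely generated structure in J is finitely generated. Then J is closed under free amalgamation (with respect to J) if and only if for all finitely generated A, B, C in J with B a common substructure of A and C, a free amalgam of A and C over B with respect to J exists and is a finitely generated structure in J. -/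
open FirstOrder FirstOrder.Language

universe u v w

/-- A class `J` of `L`-structures is closed under free amalgamation if any two
structures of `J` with a common substructure (given by a pair of embeddings of a
structure of `J`) have a free amalgam over it inside `J`. -/
def ClosedUnderFreeAmalgamation (L : FirstOrder.Language.{u, v})
    (J : Set (CategoryTheory.Bundled.{w} L.Structure)) : Prop :=
  ∀ A ∈ J, ∀ B ∈ J, ∀ C ∈ J, ∀ (g0 : B ↪[L] A) (g1 : B ↪[L] C),
    ∃ D ∈ J, ∃ (f0 : A ↪[L] D) (f1 : C ↪[L] D),
      f0.comp g0 = f1.comp g1 ∧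
      IsFreeAmalgamIn L J f0.toHom.range ((f0.comp g0).toHom.range) f1.toHom.range ⊤

section Aux

open FirstOrder.Language.Structure Filter

theorem isFree_iff (L : FirstOrder.Language.{u, v})
    (J : Set (CategoryTheory.Bundled.{w} L.Structure))
    {A B C D : Type w} [L.Structure A] [L.Structure B] [L.Structure C] [L.Structure D]
    (g0 : B ↪[L] A) (g1 : B ↪[L] C) (f0 : A ↪[L] D) (f1 : C ↪[L] D)
    (hc : f0.comp g0 = f1.comp g1) :
    IsFreeAmalgamIn L J f0.toHom.range ((f0.comp g0).toHom.range) f1.toHom.range ⊤ ↔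
    ((∀ a c, f0 a = f1 c → ∃ b, g0 b = a ∧ g1 b = c) ∧ f0.toHom.range ⊔ f1.toHom.range = ⊤ ∧
      ∀ E ∈ J, ∀ (f : A →[L] E) (g : C →[L] E), (∀ b, f (g0 b) = g (g1 b)) →
        ∃ h : D →[L] E, (∀ a, h (f0 a) = f a) ∧ ∀ c, h (f1 c) = g c) := by
  have hc' : ∀ b, f0 (g0 b) = f1 (g1 b) := fun b => by
    have := congrArg (fun e : B ↪[L] D => e b) hc
    simpa using this
  constructor
  · rintro ⟨-, -, h3, h4, h5⟩
    have key : ∀ a c, f0 a = f1 c → ∃ b, g0 b = a ∧ g1 b = c := by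
      intro a c hac
      have : f0 a ∈ f0.toHom.range ⊓ f1.toHom.range :=
        ⟨⟨a, rfl⟩, ⟨c, hac.symm⟩⟩
      rw [← h3] at this
      obtain ⟨b, hb⟩ := this
      have hb' : f0 (g0 b) = f0 a := hb
      refine ⟨b, f0.injective hb', f1.injective ?_⟩
      rw [← hc', hb', hac]
    refine ⟨key, h4, ?_⟩
    intro E hE f g hfg
    have e0 : ∀ a, f0.equivRange.symm ⟨f0 a, ⟨a, rfl⟩⟩ = a := fun a =>
      f0.equivRange.symm_apply_apply a
    have e1 : ∀ a, f1.equivRange.symm ⟨f1 a, ⟨a, rfl⟩⟩ = a := fun a =>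
      f1.equivRange.symm_apply_apply a
    obtain ⟨h, hA, hC⟩ := h5 E hE (f.comp f0.equivRange.symm.toHom)
      (g.comp f1.equivRange.symm.toHom) (by
        rintro x ⟨a, rfl⟩ ⟨c, hcx⟩
        obtain ⟨b, rfl, rfl⟩ := key a c hcx.symm
        change f (f0.equivRange.symm ⟨f0 (g0 b), _⟩) = g (f1.equivRange.symm ⟨f0 (g0 b), _⟩)
        simp only [e0]
        simp only [hc', e1]
        exact hfg b)
    refine ⟨h.comp (Substructure.topEquiv (L := L) (M := D)).symm.toHom, fun a => ?_, fun c => ?_⟩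
    · refine (hA (f0 a) ⟨a, rfl⟩ trivial).trans ?_
      exact congrArg f (e0 a)
    · refine (hC (f1 c) ⟨c, rfl⟩ trivial).trans ?_
      exact congrArg g (e1 c)
  · rintro ⟨key, h4, h5⟩
    refine ⟨le_top, le_top, ?_, h4, ?_⟩
    · ext x
      constructor
      · rintro ⟨b, rfl⟩
        exact ⟨⟨g0 b, rfl⟩, ⟨g1 b, (hc' b).symm⟩⟩
      · rintro ⟨⟨a, rfl⟩, ⟨c, hcx⟩⟩
        obtain ⟨b, rfl, rfl⟩ := key a c hcx.symm
        exact ⟨b, rfl⟩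
    · intro E hE f g hfg
      obtain ⟨h, hA, hC⟩ := h5 E hE (f.comp f0.equivRange.toHom) (g.comp f1.equivRange.toHom) (by
        intro b
        refine (hfg (f0 (g0 b)) ⟨g0 b, rfl⟩ ⟨g1 b, (hc' b).symm⟩).trans ?_
        change g ⟨_, _⟩ = g ⟨f1 (g1 b), _⟩
        congr 2
        exact hc' b)
      refine ⟨h.comp (⊤ : L.Substructure D).subtype.toHom, ?_, ?_⟩
      · rintro x ⟨a, rfl⟩ _
        exact hA a
      · rintro x ⟨a, rfl⟩ _
        exact hC a

theorem relMap_product {L : FirstOrder.Language.{u, v}} {I : Type w} (U : Ultrafilter I)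
    (M : I → Type w) [∀ k, L.Structure (M k)] {n : ℕ} (r : L.Relations n) (x : Fin n → ∀ k, M k) :
    (RelMap r fun i => (x i : (U : Filter I).Product M)) ↔
      ∀ᶠ k in (U : Filter I), RelMap r fun i => x i k := by
  exact relMap_quotient_mk' (L := L) (s := (U : Filter I).productSetoid M) r x

theorem exists_embed {L : FirstOrder.Language.{u, v}} {I : Type w} (U : Ultrafilter I)
    (M : I → Type w) [∀ k, L.Structure (M k)] [∀ k, Nonempty (M k)]
    {A : Type w} [L.Structure A] (S : I → L.Substructure A) (e : ∀ k, S k ↪[L] M k)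
    (hS : ∀ a, ∀ᶠ k in (U : Filter I), a ∈ S k) :
    ∃ (F : A ↪[L] (U : Filter I).Product M) (s : A → ∀ k, M k),
      (∀ a, F a = (s a : (U : Filter I).Product M)) ∧
      ∀ a k (h : a ∈ S k), s a k = e k ⟨a, h⟩ := by
  classical
  let s : A → ∀ k, M k := fun a k =>
    if h : a ∈ S k then e k ⟨a, h⟩ else Classical.arbitrary (M k)
  have hs : ∀ a k (h : a ∈ S k), s a k = e k ⟨a, h⟩ := fun a k h => dif_pos h
  have hS' : ∀ {n : ℕ} (x : Fin n → A), ∀ᶠ k in (U : Filter I), ∀ i, x i ∈ S k := fun x =>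
    eventually_all.2 fun i => hS (x i)
  refine ⟨{ toFun := fun a => (s a : (U : Filter I).Product M), inj' := ?_, map_fun' := ?_,
            map_rel' := ?_ }, s, fun a => rfl, hs⟩
  · intro a b hab
    have h : ∀ᶠ k in (U : Filter I), s a k = s b k := Quotient.eq''.1 hab
    obtain ⟨k, h1, h2, h3⟩ := (h.and ((hS a).and (hS b))).exists
    rw [hs a k h2, hs b k h3] at h1
    exact congrArg Subtype.val ((e k).injective h1)
  · intro n f x
    refine Eq.trans ?_ (Ultraproduct.funMap_cast f (fun i => s (x i))).symm
    refine Quotient.eq''.2 ?_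
    change ∀ᶠ k in (U : Filter I), s (funMap f x) k = funMap f fun i => s (x i) k
    filter_upwards [hS' x] with k hk
    have h1 : (fun i => s (x i) k) = e k ∘ fun i => (⟨x i, hk i⟩ : S k) := by
      funext i; exact hs _ _ (hk i)
    rw [h1, ← Embedding.map_fun, hs _ _ ((S k).fun_mem f x hk)]
    rfl
  · intro n r x
    refine (relMap_product U M r (fun i => s (x i))).trans ?_
    have : ∀ᶠ k in (U : Filter I), ((RelMap r fun i => s (x i) k) ↔ RelMap r x) := by
      filter_upwards [hS' x] with k hk
      have h1 : (fun i => s (x i) k) = e k ∘ fun i => (⟨x i, hk i⟩ : S k) := by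
        funext i; exact hs _ _ (hk i)
      rw [h1, Embedding.map_rel]
      rfl
    rw [eventually_congr this]
    simp

theorem exists_prodHom {L : FirstOrder.Language.{u, v}} {I : Type w} (U : Ultrafilter I)
    (M N : I → Type w) [∀ k, L.Structure (M k)] [∀ k, L.Structure (N k)]
    (h : ∀ k, M k →[L] N k) :
    ∃ H : (U : Filter I).Product M →[L] (U : Filter I).Product N,
      ∀ x : ∀ k, M k, H (x : (U : Filter I).Product M) =
        ((fun k => h k (x k) : ∀ k, N k) : (U : Filter I).Product N) := by
  let φ : (U : Filter I).Product M → (U : Filter I).Product N :=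
    Quotient.map' (fun x k => h k (x k)) (by
      intro x y hxy
      have hxy' : ∀ᶠ k in (U : Filter I), x k = y k := hxy
      change ∀ᶠ k in (U : Filter I), h k (x k) = h k (y k)
      filter_upwards [hxy'] with k hk
      rw [hk])
  have hφ : ∀ x : ∀ k, M k, φ (x : (U : Filter I).Product M) =
        ((fun k => h k (x k) : ∀ k, N k) : (U : Filter I).Product N) := fun x => rfl
  have lift : ∀ {n : ℕ} (x : Fin n → (U : Filter I).Product M),
      ∃ y : Fin n → ∀ k, M k, x = fun i => (y i : (U : Filter I).Product M) := by
    intro n x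
    choose y hy using fun i => Quotient.exists_rep (x i)
    exact ⟨y, funext fun i => (hy i).symm⟩
  refine ⟨{ toFun := φ, map_fun' := ?_, map_rel' := ?_ }, hφ⟩
  · intro n f x
    obtain ⟨y, rfl⟩ := lift x
    refine (congrArg φ (Ultraproduct.funMap_cast f y)).trans ?_
    refine (hφ _).trans ?_
    refine Eq.trans ?_ (Ultraproduct.funMap_cast f (fun i k => h k (y i k))).symm
    congr 1
    funext k
    exact (h k).map_fun f _
  · intro n r x hx
    obtain ⟨y, rfl⟩ := lift x
    replace hx := (relMap_product U M r y).1 hx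
    refine (relMap_product U N r (fun i k => h k (y i k))).2 ?_
    filter_upwards [hx] with k hk
    exact (h k).map_rel r _ hk

end Aux

/-- let `T` be a universal theory whose class of models `J` is such that
substructures of finitely generated models are finitely generated.  Then `J` is
closed under free amalgamation iff the finitely generated structures in `J` are
(with finitely generated free amalgams). -/
theorem closedUnderFreeAmalgamation_iff_fg (L : FirstOrder.Language.{u, v})
    (T : L.Theory) (hT : T.IsUniversal)
    (J : Set (CategoryTheory.Bundled.{w} L.Structure))
    (hJ : J = {E : CategoryTheory.Bundled.{w} L.Structure | (E : Type w) ⊨ T})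
    (hfg : ∀ E ∈ J, Structure.FG L E → ∀ S : L.Substructure E, S.FG) :
    ClosedUnderFreeAmalgamation L J ↔
      (∀ A ∈ J, ∀ B ∈ J, ∀ C ∈ J,
        Structure.FG L A → Structure.FG L B → Structure.FG L C →
        ∀ (g0 : B ↪[L] A) (g1 : B ↪[L] C),
          ∃ D ∈ J, Structure.FG L D ∧ ∃ (f0 : A ↪[L] D) (f1 : C ↪[L] D),
            f0.comp g0 = f1.comp g1 ∧
            IsFreeAmalgamIn L J f0.toHom.range ((f0.comp g0).toHom.range)
              f1.toHom.range ⊤) := by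
  classical
  subst hJ
  have := hT
  constructor
  · intro h A hA B hB C hC fA fB fC g0 g1
    obtain ⟨D, hD, f0, f1, hc, hf⟩ := h A hA B hB C hC g0 g1
    refine ⟨D, hD, ?_, f0, f1, hc, hf⟩
    rw [Structure.fg_def, ← hf.2.2.2.1]
    exact (fA.range _).sup (fC.range _)
  · intro h A hA B hB C hC g0 g1
    rcases isEmpty_or_nonempty A with hAe | ⟨⟨a0⟩⟩
    · have hsurj : Function.Surjective g0 := fun a => isEmptyElim a
      have htop : ∀ a, a ∈ g0.toHom.range := fun a => isEmptyElim a
      let f0 : A ↪[L] C := g1.comp (g0.equivRange.symm.toEmbedding.comp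
        ((Embedding.refl L A).codRestrict g0.toHom.range htop))
      have hc : f0.comp g0 = (Embedding.refl L C).comp g1 := by
        ext b; exact isEmptyElim (g0 b)
      refine ⟨C, hC, f0, Embedding.refl L C, hc, ?_⟩
      rw [isFree_iff L _ g0 g1 _ _ hc]
      refine ⟨fun a => isEmptyElim a, ?_, ?_⟩
      · rw [eq_top_iff]
        intro x _
        exact (le_sup_right : (Embedding.refl L C).toHom.range ≤ _) ⟨x, rfl⟩
      · intro E hE f g _
        exact ⟨g, fun a => isEmptyElim a, fun c => rfl⟩
    let I := Finset A × Finset C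
    let SA : I → L.Substructure A := fun k => Substructure.closure L (insert a0 (k.1 : Set A))
    let SC : I → L.Substructure C := fun k => Substructure.closure L (k.2 : Set C)
    let SB : I → L.Substructure B := fun k => (SA k).comap g0.toHom ⊓ (SC k).comap g1.toHom
    let b0 : ∀ k, SB k ↪[L] SA k := fun k =>
      (g0.comp (SB k).subtype).codRestrict (SA k) (fun b => b.2.1)
    let b1 : ∀ k, SB k ↪[L] SC k := fun k =>
      (g1.comp (SB k).subtype).codRestrict (SC k) (fun b => b.2.2)
    have sub : ∀ (X : CategoryTheory.Bundled.{w} L.Structure) (_ : (X : Type w) ⊨ T)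
        (S : L.Substructure X), (S : Type w) ⊨ T := fun X hX S =>
      haveI := hX
      Theory.IsUniversal.models_of_embedding S.subtype
    have fgA : ∀ k, Structure.FG L (SA k) := fun k =>
      (Substructure.fg_iff_structure_fg _).1
        (Substructure.fg_closure ((Finset.finite_toSet _).insert a0))
    have fgC : ∀ k, Structure.FG L (SC k) := fun k =>
      (Substructure.fg_iff_structure_fg _).1 (Substructure.fg_closure (Finset.finite_toSet _))
    have fgB : ∀ k, Structure.FG L (SB k) := fun k => by
      have := hfg ⟨SA k, inferInstance⟩ (sub A hA _) (fgA k) (b0 k).toHom.range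
      rw [Substructure.fg_iff_structure_fg] at this
      exact (b0 k).equivRange.fg_iff.2 this
    have main := fun k => h ⟨SA k, inferInstance⟩ (sub A hA _) ⟨SB k, inferInstance⟩ (sub B hB _)
      ⟨SC k, inferInstance⟩ (sub C hC _) (fgA k) (fgB k) (fgC k) (b0 k) (b1 k)
    choose M hM _ e0 e1 hc hfree using main
    have hc' : ∀ k b, e0 k (b0 k b) = e1 k (b1 k b) := fun k b =>
      congrArg (fun e : SB k ↪[L] M k => e b) (hc k)
    have hfree' := fun k => (isFree_iff L _ (b0 k) (b1 k) (e0 k) (e1 k) (hc k)).1 (hfree k)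
    have a0mem : ∀ k, a0 ∈ SA k := fun k => Substructure.subset_closure (Set.mem_insert _ _)
    have : ∀ k, Nonempty (M k) := fun k => ⟨e0 k ⟨a0, a0mem k⟩⟩
    have : (Filter.atTop : Filter I).NeBot := inferInstance
    let U : Ultrafilter I := Ultrafilter.of Filter.atTop
    have hU : (U : Filter I) ≤ Filter.atTop := Ultrafilter.of_le Filter.atTop
    have evA : ∀ a, ∀ᶠ k in (U : Filter I), a ∈ SA k := fun a => hU <| by
      filter_upwards [Filter.eventually_ge_atTop (({a}, ∅) : I)] with k hk
      exact Substructure.subset_closure (Set.mem_insert_of_mem _ (hk.1 (by simp)))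
    have evC : ∀ c, ∀ᶠ k in (U : Filter I), c ∈ SC k := fun c => hU <| by
      filter_upwards [Filter.eventually_ge_atTop ((∅, {c}) : I)] with k hk
      exact Substructure.subset_closure (hk.2 (by simp))
    let P := (U : Filter I).Product (fun k => (M k : Type w))
    obtain ⟨FA, sA, hFA, hsA⟩ := exists_embed U (fun k => (M k : Type w)) SA e0 evA
    obtain ⟨FC, sC, hFC, hsC⟩ := exists_embed U (fun k => (M k : Type w)) SC e1 evC
    have hP : P ⊨ T := by
      rw [Theory.model_iff]
      intro φ hφ
      refine (Ultraproduct.sentence_realize φ).2 (Filter.Eventually.of_forall fun k => ?_)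
      exact (Theory.model_iff T).1 (hM k) φ hφ
    let D : L.Substructure P := FA.toHom.range ⊔ FC.toHom.range
    have mA : ∀ a, FA a ∈ D := fun a =>
      (le_sup_left : FA.toHom.range ≤ D) ⟨a, rfl⟩
    have mC : ∀ c, FC c ∈ D := fun c =>
      (le_sup_right : FC.toHom.range ≤ D) ⟨c, rfl⟩
    let f0 : A ↪[L] D := FA.codRestrict D mA
    let f1 : C ↪[L] D := FC.codRestrict D mC
    have hFe : ∀ a c, FA a = FC c ↔ ∀ᶠ k in (U : Filter I), sA a k = sC c k := by
      intro a c
      rw [hFA, hFC]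
      exact Quotient.eq''
    have hcomm : f0.comp g0 = f1.comp g1 := by
      ext b
      change FA (g0 b) = FC (g1 b)
      rw [hFe]
      filter_upwards [evA (g0 b), evC (g1 b)] with k h0 h1
      rw [hsA _ _ h0, hsC _ _ h1]
      exact hc' k ⟨b, h0, h1⟩
    refine ⟨⟨D, inferInstance⟩, sub ⟨P, inferInstance⟩ hP D, f0, f1, hcomm, ?_⟩
    refine (isFree_iff L _ g0 g1 f0 f1 hcomm).2 ⟨?_, ?_, ?_⟩
    · intro a c hac
      have hac' : FA a = FC c := congrArg Subtype.val hac
      rw [hFe] at hac'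
      obtain ⟨k, h1, h2, h3⟩ := (hac'.and ((evA a).and (evC c))).exists
      rw [hsA _ _ h2, hsC _ _ h3] at h1
      obtain ⟨b, hb0, hb1⟩ := (hfree' k).1 _ _ h1
      exact ⟨b.1, congrArg Subtype.val hb0, congrArg Subtype.val hb1⟩
    · rw [eq_top_iff]
      have : D ≤ (f0.toHom.range ⊔ f1.toHom.range).map D.subtype.toHom := by
        refine sup_le ?_ ?_
        · rintro x ⟨a, rfl⟩
          exact ⟨f0 a, (le_sup_left : f0.toHom.range ≤ f0.toHom.range ⊔ f1.toHom.range) ⟨a, rfl⟩, rfl⟩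
        · rintro x ⟨a, rfl⟩
          exact ⟨f1 a, (le_sup_right : f1.toHom.range ≤ f0.toHom.range ⊔ f1.toHom.range) ⟨a, rfl⟩, rfl⟩
      rintro ⟨x, hx⟩ _
      obtain ⟨y, hy, hyx⟩ := this hx
      have : y = ⟨x, hx⟩ := Subtype.ext hyx
      exact this ▸ hy
    · intro E hE f g hfg'
      have ex := fun k => (hfree' k).2.2 E hE (f.comp (SA k).subtype.toHom)
        (g.comp (SC k).subtype.toHom) (fun b => hfg' b.1)
      choose hk hk0 hk1 using ex
      obtain ⟨H, hH⟩ := exists_prodHom U (fun k => (M k : Type w)) (fun _ => (E : Type w)) hk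
      have : Nonempty E := ⟨f a0⟩
      obtain ⟨Δ, sE, hΔ, hsE⟩ := exists_embed U (fun _ => (E : Type w))
        (fun _ => (⊤ : L.Substructure E)) (fun _ => (⊤ : L.Substructure E).subtype)
        (fun a => Filter.Eventually.of_forall fun _ => trivial)
      have HA : ∀ a, H (FA a) = Δ (f a) := by
        intro a
        rw [hFA, hH, hΔ]
        refine Quotient.eq''.2 ?_
        change ∀ᶠ k in (U : Filter I), hk k (sA a k) = sE (f a) k
        filter_upwards [evA a] with k hka
        rw [hsA _ _ hka, hsE _ _ trivial]
        exact hk0 k ⟨a, hka⟩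
      have HC : ∀ c, H (FC c) = Δ (g c) := by
        intro a
        rw [hFC, hH, hΔ]
        refine Quotient.eq''.2 ?_
        change ∀ᶠ k in (U : Filter I), hk k (sC a k) = sE (g a) k
        filter_upwards [evC a] with k hka
        rw [hsC _ _ hka, hsE _ _ trivial]
        exact hk1 k ⟨a, hka⟩
      have hD : D ≤ Δ.toHom.range.comap H := by
        refine sup_le ?_ ?_
        · rintro x ⟨a, rfl⟩
          exact ⟨f a, (HA a).symm⟩
        · rintro x ⟨a, rfl⟩
          exact ⟨g a, (HC a).symm⟩
      let h' : D →[L] Δ.toHom.range :=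
        (H.comp D.subtype.toHom).codRestrict Δ.toHom.range (fun x => hD x.2)
      have hh' : ∀ x, Δ (Δ.equivRange.symm (h' x)) = H x.1 := by
        intro x
        rw [← Embedding.equivRange_apply, FirstOrder.Language.Equiv.apply_symm_apply]
        rfl
      refine ⟨Δ.equivRange.symm.toHom.comp h', fun a => Δ.injective ?_, fun a => Δ.injective ?_⟩
      · exact (hh' (f0 a)).trans (HA a)
      · exact (hh' (f1 a)).trans (HC a)
end

section
/- Fix a field K and an integer c ≥ 1. Let A, B, C be c-nilpotent graded Lie algebras over K with injective graded homomorphisms g0 : B → A and g1 : B → C. Then there exist a c-nilpotent graded Lie algebra D over K and injective graded homomorphisms f0 : A → D and f1 : C → D with f0 ∘ g0 = f1 ∘ g1, such that f0(A) ∩ f1(C) = f0(g0(B)), D is generated as a Lie algebra by f0(A) ∪ f1(C), and for every c-nilpotent graded Lie algebra E over K and all graded homomorphisms f : A → E and g : C → E with f ∘ g0 = g ∘ g1, there is a graded homomorphism h : D → E with h ∘ f0 = f and h ∘ f1 = g. That is, the class of c-nilpotent graded Lie algebras over K is closed under free amalgamation. -/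
universe u

/-- A `c`-nilpotent graded Lie algebra over `K`: a Lie algebra together with
submodules `piece i` such that the algebra is their internal direct sum
(`piece 0 = ⊥` and `piece n = ⊥` for `n > c`) and `⁅piece i, piece j⁆ ⊆ piece (i + j)`. -/
structure CNilpGradedLieAlg (K : Type u) [Field K] (c : ℕ) where
  carrier : Type u
  [lieRing : LieRing carrier]
  [lieAlgebra : LieAlgebra K carrier]
  piece : ℕ → Submodule K carrier
  isInternal : DirectSum.IsInternal piece
  piece_zero : piece 0 = ⊥
  piece_of_gt : ∀ n, c < n → piece n = ⊥
  lie_mem : ∀ i j (x y : carrier), x ∈ piece i → y ∈ piece j → ⁅x, y⁆ ∈ piece (i + j)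

attribute [instance] CNilpGradedLieAlg.lieRing CNilpGradedLieAlg.lieAlgebra

instance (K : Type u) [Field K] (c : ℕ) : CoeSort (CNilpGradedLieAlg K c) (Type u) :=
  ⟨CNilpGradedLieAlg.carrier⟩

/-- A Lie algebra homomorphism between graded Lie algebras is graded if it maps the
`i`-th component into the `i`-th component for every `i`. -/
def LieHomIsGraded {K : Type u} [Field K] {c : ℕ} (A B : CNilpGradedLieAlg K c)
    (f : A →ₗ⁅K⁆ B) : Prop :=
  ∀ i (x : A), x ∈ A.piece i → f x ∈ B.piece i

set_option linter.unusedVariables false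

set_option linter.unusedSectionVars false
namespace PBW
open Classical

variable {K : Type u} [Field K] {L : Type u} [LieRing L] [LieAlgebra K L]
variable {ι : Type u} [LinearOrder ι]

/-- monomials -/
noncomputable abbrev z (K : Type u) [Field K] {ι : Type u} (M : Multiset ι) : Multiset ι →₀ K :=
  Finsupp.single M 1

noncomputable def mn (M : Multiset ι) (h : M ≠ 0) : ι :=
  (Multiset.exists_min_image (fun x : ι => x) h).choose

lemma mn_mem (M : Multiset ι) (h : M ≠ 0) : mn M h ∈ M :=
  (Multiset.exists_min_image (fun x : ι => x) h).choose_spec.1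

lemma mn_le (M : Multiset ι) (h : M ≠ 0) : ∀ k ∈ M, mn M h ≤ k :=
  (Multiset.exists_min_image (fun x : ι => x) h).choose_spec.2

lemma mn_cons (j : ι) (N : Multiset ι) (hj : ∀ k ∈ N, j ≤ k) (h : j ::ₘ N ≠ 0) :
    mn (j ::ₘ N) h = j := by
  apply le_antisymm
  · exact mn_le _ h j (by simp)
  · have := mn_mem _ h
    rcases Multiset.mem_cons.1 this with h1 | h1
    · exact h1.ge
    · exact hj _ h1

lemma exists_min_cons (M : Multiset ι) (h : M ≠ 0) :
    ∃ j N, M = j ::ₘ N ∧ ∀ k ∈ N, j ≤ k :=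
  ⟨mn M h, M.erase (mn M h), (Multiset.cons_erase (mn_mem M h)).symm,
    fun k hk => mn_le M h k (Multiset.mem_of_mem_erase hk)⟩

noncomputable def step (b : Module.Basis ι K L)
    (g : L →ₗ[K] (Multiset ι →₀ K) →ₗ[K] (Multiset ι →₀ K)) (i : ι) (M : Multiset ι) :
    Multiset ι →₀ K :=
  if h : ∃ j ∈ M, j < i then
    have h0 : M ≠ 0 := by rintro rfl; simp at h
    z K (i ::ₘ M) + g (b (mn M h0)) (g (b i) (z K (M.erase (mn M h0)))
      - z K (i ::ₘ (M.erase (mn M h0)))) + g ⁅b i, b (mn M h0)⁆ (z K (M.erase (mn M h0)))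
  else z K (i ::ₘ M)

lemma step_le (b : Module.Basis ι K L) (g) (i : ι) (M : Multiset ι) (h : ∀ k ∈ M, i ≤ k) :
    step b g i M = z K (i ::ₘ M) := by
  rw [step, dif_neg]
  push Not
  exact h

lemma step_cons (b : Module.Basis ι K L) (g) (i j : ι) (N : Multiset ι) (h : ∀ k ∈ N, j ≤ k)
    (hij : j < i) :
    step b g i (j ::ₘ N) = z K (i ::ₘ j ::ₘ N) + g (b j) (g (b i) (z K N) - z K (i ::ₘ N))
      + g ⁅b i, b j⁆ (z K N) := by
  rw [step, dif_pos ⟨j, by simp, hij⟩]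
  simp only [mn_cons j N h, Multiset.erase_cons_head]

noncomputable def ext (b : Module.Basis ι K L) (s : ι → Multiset ι → (Multiset ι →₀ K)) :
    L →ₗ[K] (Multiset ι →₀ K) →ₗ[K] (Multiset ι →₀ K) :=
  b.constr K (fun i => Finsupp.linearCombination K (s i))

lemma ext_apply (b : Module.Basis ι K L) (s) (i : ι) (M : Multiset ι) :
    ext b s (b i) (z K M) = s i M := by
  simp [ext, Module.Basis.constr_basis]

noncomputable def f (b : Module.Basis ι K L) :
    ℕ → (L →ₗ[K] (Multiset ι →₀ K) →ₗ[K] (Multiset ι →₀ K))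
  | 0 => 0
  | n + 1 => ext b (step b (f b n))

/-- length filtration -/
noncomputable def V (K : Type u) [Field K] (ι : Type u) (n : ℕ) : Submodule K (Multiset ι →₀ K) :=
  Submodule.span K {v | ∃ M : Multiset ι, M.card ≤ n ∧ v = z K M}

lemma z_mem {M : Multiset ι} {n : ℕ} (h : M.card ≤ n) : z K M ∈ V K ι n :=
  Submodule.subset_span ⟨M, h, rfl⟩

lemma V_mono {m n : ℕ} (h : m ≤ n) : V K ι m ≤ V K ι n := by
  apply Submodule.span_mono
  rintro _ ⟨M, hM, rfl⟩
  exact ⟨M, hM.trans h, rfl⟩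

lemma V_ind {n : ℕ} {p : Submodule K (Multiset ι →₀ K)}
    (h : ∀ M : Multiset ι, M.card ≤ n → z K M ∈ p) : V K ι n ≤ p := by
  apply Submodule.span_le.2
  rintro _ ⟨M, hM, rfl⟩
  exact h M hM

/-- check on basis -/
lemma basis_mem (b : Module.Basis ι K L) (φ : L →ₗ[K] (Multiset ι →₀ K))
    (p : Submodule K (Multiset ι →₀ K)) (h : ∀ i, φ (b i) ∈ p) (x : L) : φ x ∈ p := by
  have : (⊤ : Submodule K L) ≤ p.comap φ := by
    rw [← b.span_eq, Submodule.span_le]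
    rintro _ ⟨i, rfl⟩
    exact h i
  exact this (Submodule.mem_top)

lemma V_eq {n : ℕ} {W : Type*} [AddCommGroup W] [Module K W] (φ ψ : (Multiset ι →₀ K) →ₗ[K] W)
    (h : ∀ M : Multiset ι, M.card ≤ n → φ (z K M) = ψ (z K M)) :
    ∀ v ∈ V K ι n, φ v = ψ v := by
  intro v hv
  have : V K ι n ≤ LinearMap.eqLocus φ ψ := V_ind h
  exact this hv

lemma deg_of (b : Module.Basis ι K L) (g : L →ₗ[K] (Multiset ι →₀ K) →ₗ[K] (Multiset ι →₀ K))
    (n : ℕ) (h : ∀ (i : ι) (M : Multiset ι), M.card < n →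
      g (b i) (z K M) - z K (i ::ₘ M) ∈ V K ι M.card) (k : ℕ) (hk : k < n) (x : L) :
    ∀ v ∈ V K ι k, g x v ∈ V K ι (k + 1) := by
  intro v hv
  have : V K ι k ≤ (V K ι (k+1)).comap (g x) := by
    apply V_ind
    intro M hM
    rw [Submodule.mem_comap]
    refine basis_mem b (g.flip (z K M)) (V K ι (k+1)) (fun i => ?_) x
    have := V_mono (K := K) (ι := ι) (hM.trans (Nat.le_succ k)) (h i M (by omega))
    have h2 : z K (i ::ₘ M) ∈ V K ι (k+1) := z_mem (by simpa using hM)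
    simpa using add_mem this h2
  exact this hv

lemma f_main (b : Module.Basis ι K L) (n : ℕ) :
    (∀ (x : L) (M : Multiset ι), M.card < n → f b n x (z K M) = f b (n+1) x (z K M)) ∧
    (∀ (i : ι) (M : Multiset ι), M.card < n →
      f b n (b i) (z K M) - z K (i ::ₘ M) ∈ V K ι M.card) := by
  induction n with
  | zero => simp
  | succ n ih =>
    obtain ⟨ih1, ih2⟩ := ih
    have key : ∀ (i : ι) (M : Multiset ι), M.card < n + 1 →
        step b (f b n) i M = step b (f b (n+1)) i M ∧
        step b (f b n) i M - z K (i ::ₘ M) ∈ V K ι M.card := by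
      intro i M hM
      by_cases hi : ∀ k ∈ M, i ≤ k
      · rw [step_le _ _ _ _ hi, step_le _ _ _ _ hi]; simp
      · have h0 : M ≠ 0 := by rintro rfl; simp at hi
        obtain ⟨j, N, rfl, hj⟩ := exists_min_cons M h0
        have hij : j < i := by
          push Not at hi
          obtain ⟨k, hk, hki⟩ := hi
          rcases Multiset.mem_cons.1 hk with rfl | hk
          · exact hki
          · exact (hj k hk).trans_lt hki
        have hN : N.card < n := by simpa using hM
        rw [step_cons _ _ _ _ _ hj hij, step_cons _ _ _ _ _ hj hij]
        have hw := ih2 i N hN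
        constructor
        · rw [← ih1 _ N hN, ← ih1 _ N hN,
            V_eq (f b n (b j)) (f b (n+1) (b j)) (fun M hM => ih1 _ M (hM.trans_lt hN)) _ hw]
        · have d1 := deg_of b _ n ih2 _ hN (b j) _ hw
          have d2 := deg_of b _ n ih2 _ hN ⁅b i, b j⁆ _ (z_mem (K := K) (le_refl N.card))
          rw [Multiset.card_cons]
          convert add_mem d1 d2 using 1
          abel
    constructor
    · intro x M hM
      have := basis_mem b ((f b (n+1)).flip (z K M) - (f b (n+1+1)).flip (z K M)) ⊥ (fun i => by
        simp only [LinearMap.sub_apply, LinearMap.flip_apply, Submodule.mem_bot]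
        rw [f, ext_apply, f, ext_apply, sub_eq_zero]
        exact (key i M hM).1) x
      simpa [sub_eq_zero] using this
    · intro i M hM
      rw [f, ext_apply]
      exact (key i M hM).2

lemma f_stable (b : Module.Basis ι K L) (M : Multiset ι) (n : ℕ) (h : M.card < n) (x : L) :
    f b n x (z K M) = f b (M.card + 1) x (z K M) := by
  induction n, h using Nat.le_induction with
  | base => rfl
  | succ n hn ih => rw [← ih, ← (f_main b n).1 x M hn]

noncomputable def F (b : Module.Basis ι K L) : L →ₗ[K] (Multiset ι →₀ K) →ₗ[K] (Multiset ι →₀ K) :=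
  ext b (fun i M => f b (M.card + 1) (b i) (z K M))

lemma F_eq (b : Module.Basis ι K L) (M : Multiset ι) (n : ℕ) (h : M.card < n) (x : L) :
    F b x (z K M) = f b n x (z K M) := by
  have := basis_mem b ((F b).flip (z K M) - (f b n).flip (z K M)) ⊥ (fun i => by
        simp only [LinearMap.sub_apply, LinearMap.flip_apply, Submodule.mem_bot]
        rw [F, ext_apply, f_stable b M n h, sub_self]) x
  simpa [sub_eq_zero] using this

lemma F_le (b : Module.Basis ι K L) (i : ι) (M : Multiset ι) (h : ∀ k ∈ M, i ≤ k) :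
    F b (b i) (z K M) = z K (i ::ₘ M) := by
  rw [F_eq b M _ (Nat.lt_succ_self _), f, ext_apply, step_le _ _ _ _ h]

lemma F_deg (b : Module.Basis ι K L) (i : ι) (M : Multiset ι) :
    F b (b i) (z K M) - z K (i ::ₘ M) ∈ V K ι M.card := by
  rw [F_eq b M _ (Nat.lt_succ_self _)]
  exact (f_main b _).2 i M (Nat.lt_succ_self _)

lemma F_lt' (b : Module.Basis ι K L) (i j : ι) (N : Multiset ι) (h : ∀ k ∈ N, j ≤ k)
    (hij : j < i) :
    F b (b i) (z K (j ::ₘ N)) = z K (i ::ₘ j ::ₘ N) + F b (b j) (F b (b i) (z K N) - z K (i ::ₘ N))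
      + F b ⁅b i, b j⁆ (z K N) := by
  rw [V_eq (F b (b j)) (f b (N.card + 1) (b j)) (fun M hM => F_eq b M _ (by omega) _) _
    (F_deg b i N)]
  rw [F_eq b _ (N.card + 1 + 1) (by simp), f, ext_apply, step_cons _ _ _ _ _ h hij]
  rw [F_eq b N (N.card + 1) (by simp), F_eq b N (N.card + 1) (by simp)]

lemma F_lt (b : Module.Basis ι K L) (i j : ι) (N : Multiset ι) (h : ∀ k ∈ N, j ≤ k)
    (hij : j < i) :
    F b (b i) (F b (b j) (z K N)) = F b (b j) (F b (b i) (z K N)) + F b ⁅b i, b j⁆ (z K N) := by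
  rw [F_le b j N h, F_lt' b i j N h hij, map_sub, F_le b j (i ::ₘ N), Multiset.cons_swap]
  · abel
  · intro k hk
    rcases Multiset.mem_cons.1 hk with rfl | hk
    · exact hij.le
    · exact h k hk

/-- commutation at `v` -/
def Comm (b : Module.Basis ι K L) (x y : L) (v : Multiset ι →₀ K) : Prop :=
  F b x (F b y v) = F b y (F b x v) + F b ⁅x, y⁆ v

lemma Comm.symm {b : Module.Basis ι K L} {x y : L} {v : Multiset ι →₀ K} (h : Comm b x y v) :
    Comm b y x v := by
  unfold Comm at *
  rw [h, ← lie_skew y x, map_neg, LinearMap.neg_apply]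
  abel

lemma Comm.add {b : Module.Basis ι K L} {x y : L} {v w : Multiset ι →₀ K} (h : Comm b x y v)
    (h' : Comm b x y w) : Comm b x y (v + w) := by
  unfold Comm at *
  simp only [map_add, h, h']
  abel

lemma comm_min (b : Module.Basis ι K L) (i j : ι) (N : Multiset ι) (h : ∀ k ∈ N, j ≤ k) :
    Comm b (b i) (b j) (z K N) := by
  rcases lt_trichotomy j i with hij | rfl | hij
  · exact F_lt b i j N h hij
  · simp [Comm]
  · exact Comm.symm (F_lt b j i N (fun k hk => hij.le.trans (h k hk)) hij)

lemma comm_of_basis (b : Module.Basis ι K L) (v : Multiset ι →₀ K)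
    (h : ∀ i j, Comm b (b i) (b j) v) (x y : L) : Comm b x y v := by
  have h1 : ∀ i y, Comm b (b i) y v := by
    intro i y
    have := basis_mem b (F b (b i) ∘ₗ (F b).flip v - (F b).flip (F b (b i) v)
      - (F b).flip v ∘ₗ (LieAlgebra.ad K L (b i))) ⊥ (fun j => by
        have := h i j
        unfold Comm at this
        simp [this]) y
    unfold Comm
    simp only [LinearMap.sub_apply, LinearMap.comp_apply, LinearMap.flip_apply,
      Submodule.mem_bot, LieAlgebra.ad_apply] at this
    rw [sub_sub, sub_eq_zero] at this
    exact this
  have := basis_mem b ((F b).flip (F b y v) - F b y ∘ₗ (F b).flip v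
      + (F b).flip v ∘ₗ (LieAlgebra.ad K L y)) ⊥ (fun j => by
        have := h1 j y
        unfold Comm at this
        simp only [LinearMap.sub_apply, LinearMap.comp_apply, LinearMap.flip_apply,
          Submodule.mem_bot, LieAlgebra.ad_apply, LinearMap.add_apply]
        rw [this, ← lie_skew y (b j), map_neg, LinearMap.neg_apply]; abel) x
  unfold Comm
  simp only [LinearMap.sub_apply, LinearMap.comp_apply, LinearMap.flip_apply,
      Submodule.mem_bot, LieAlgebra.ad_apply, LinearMap.add_apply] at this
  rw [← lie_skew]
  rw [map_neg, LinearMap.neg_apply, ← sub_eq_zero, ← this]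
  abel

lemma comm_ind (b : Module.Basis ι K L) (n : ℕ) : ∀ (N : Multiset ι), N.card ≤ n →
    ∀ x y, Comm b x y (z K N) := by
  induction n with
  | zero =>
    intro N hN
    obtain rfl : N = 0 := by simpa using hN
    exact comm_of_basis b _ fun i j => comm_min b i j _ (by simp)
  | succ n ih =>
    intro N hN
    apply comm_of_basis
    intro i j
    by_cases hj : ∀ k ∈ N, j ≤ k
    · exact comm_min b i j N hj
    by_cases hi : ∀ k ∈ N, i ≤ k
    · exact (comm_min b j i N hi).symm
    have h0 : N ≠ 0 := by rintro rfl; simp at hi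
    obtain ⟨k, P, rfl, hk⟩ := exists_min_cons N h0
    have lt_of : ∀ i : ι, (¬ ∀ l ∈ k ::ₘ P, i ≤ l) → k < i := by
      intro i hi
      push Not at hi
      obtain ⟨l, hl, hli⟩ := hi
      rcases Multiset.mem_cons.1 hl with rfl | hl
      · exact hli
      · exact (hk l hl).trans_lt hli
    have hki := lt_of i hi
    have hkj := lt_of j hj
    have hP : P.card ≤ n := by simpa using hN
    have ihV : ∀ v ∈ V K ι P.card, ∀ x y, Comm b x y v := by
      intro v hv x y
      have := V_eq (F b x ∘ₗ F b y) (F b y ∘ₗ F b x + F b ⁅x, y⁆)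
        (fun M hM => ih M (hM.trans hP) x y) v hv
      exact this
    -- key
    have key : ∀ i j : ι, k < i → k < j → Comm b (b i) (b k) (F b (b j) (z K P)) := by
      intro i j hki hkj
      have e : F b (b j) (z K P) = z K (j ::ₘ P) + (F b (b j) (z K P) - z K (j ::ₘ P)) := by abel
      rw [e]
      refine Comm.add (comm_min b i k _ ?_) (ihV _ (F_deg b j P) _ _)
      intro l hl
      rcases Multiset.mem_cons.1 hl with rfl | hl
      · exact hkj.le
      · exact hk l hl
    have k1 := key i j hki hkj
    have k2 := key j i hkj hki
    have p := ih P hP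
    have p1 := p (b j) (b k)
    have p2 := p (b i) (b k)
    have p3 := p (b i) (b j)
    have p4 := p ⁅b i, b j⁆ (b k)
    have p5 := p ⁅b i, b k⁆ (b j)
    have p6 := p (b i) ⁅b j, b k⁆
    have jac : ⁅⁅b i, b j⁆, b k⁆ = ⁅⁅b i, b k⁆, b j⁆ + ⁅b i, ⁅b j, b k⁆⁆ := by
      rw [lie_lie (b i) (b j), ← lie_skew ⁅b i, b k⁆ (b j)]; abel
    unfold Comm at *
    rw [← F_le b k P hk, p1, p2, p4, jac]
    simp only [map_add, LinearMap.add_apply, k1, k2, p5, p6, p3]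
    abel

lemma F_rep (b : Module.Basis ι K L) (x y : L) (v : Multiset ι →₀ K) :
    F b x (F b y v) = F b y (F b x v) + F b ⁅x, y⁆ v := by
  have : F b x ∘ₗ F b y = F b y ∘ₗ F b x + F b ⁅x, y⁆ :=
    Finsupp.lhom_ext' fun M => LinearMap.ext_ring (comm_ind b _ M le_rfl x y)
  exact LinearMap.congr_fun this v

lemma F_zero (b : Module.Basis ι K L) (x : L) :
    F b x (z K 0) = (b.repr x).mapDomain (fun i => ({i} : Multiset ι)) := by
  have := basis_mem b ((F b).flip (z K 0) -
    Finsupp.lmapDomain K K (fun i => ({i} : Multiset ι)) ∘ₗ b.repr.toLinearMap) ⊥ (fun i => by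
      simp only [LinearMap.sub_apply, LinearMap.flip_apply, Submodule.mem_bot]
      rw [F_le b i 0 (by simp)]
      simp [Finsupp.mapDomain_single]) x
  simpa [sub_eq_zero] using this

end PBW

namespace PBW
open Classical

section rel
variable {K : Type u} [Field K] {A B : Type u} [LieRing A] [LieAlgebra K A]
  [LieRing B] [LieAlgebra K B] {ι J : Type u} [LinearOrder ι] [LinearOrder J]

def mg (P : Multiset ι) (Q : Multiset J) : Multiset (ι ⊕ₗ J) :=
  P.map (fun i => Sum.inlₗ i) + Q.map (fun j => Sum.inrₗ j)

lemma mg_cons (i : ι) (P : Multiset ι) (Q : Multiset J) :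
    mg (i ::ₘ P) Q = Sum.inlₗ i ::ₘ mg P Q := by
  simp [mg]

lemma mg_cons' (j : J) (P : Multiset ι) (Q : Multiset J) :
    mg P (j ::ₘ Q) = Sum.inrₗ j ::ₘ mg P Q := by
  simp [mg]

lemma mg_le (i : ι) (P : Multiset ι) (Q : Multiset J) (h : ∀ k ∈ P, i ≤ k) :
    ∀ k ∈ mg P Q, Sum.inlₗ i ≤ k := by
  intro k hk
  simp only [mg, Multiset.mem_add, Multiset.mem_map] at hk
  rcases hk with ⟨a, ha, rfl⟩ | ⟨a, ha, rfl⟩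
  · exact Sum.Lex.inl_le_inl_iff.2 (h a ha)
  · exact Sum.Lex.inl_le_inr _ _

lemma mg_bij : Function.Bijective (fun p : Multiset ι × Multiset J => mg p.1 p.2) := by
  constructor
  · rintro ⟨P, Q⟩ ⟨P', Q'⟩ h
    simp only at h
    have h1 := congrArg (Multiset.filterMap (fun k => (ofLex k).getLeft?)) h
    have h2 := congrArg (Multiset.filterMap (fun k => (ofLex k).getRight?)) h
    have e1 : ∀ (P : Multiset ι) (Q : Multiset J),
        Multiset.filterMap (fun k => (ofLex k).getLeft?) (mg P Q) = P := by
      intro P Q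
      induction P using Multiset.induction with
      | empty =>
        induction Q using Multiset.induction with
        | empty => simp [mg]
        | cons j Q ih => rw [mg_cons', Multiset.filterMap_cons_none _ _ (by simp), ih]
      | cons i P ih => rw [mg_cons, Multiset.filterMap_cons_some _ _ _ (b := i) (by simp), ih]
    have e2 : ∀ (P : Multiset ι) (Q : Multiset J),
        Multiset.filterMap (fun k => (ofLex k).getRight?) (mg P Q) = Q := by
      intro P Q
      induction Q using Multiset.induction with
      | empty =>
        induction P using Multiset.induction with
        | empty => simp [mg]
        | cons j Q ih => rw [mg_cons, Multiset.filterMap_cons_none _ _ (by simp), ih]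
      | cons i P ih => rw [mg_cons', Multiset.filterMap_cons_some _ _ _ (b := i) (by simp), ih]
    rw [e1, e1] at h1
    rw [e2, e2] at h2
    rw [h1, h2]
  · intro M
    induction M using Multiset.induction with
    | empty => exact ⟨(0, 0), by simp [mg]⟩
    | cons k M ih =>
      obtain ⟨⟨P, Q⟩, rfl⟩ := ih
      obtain ⟨k, rfl⟩ := toLex.surjective k
      rcases k with i | j
      · exact ⟨(i ::ₘ P, Q), mg_cons i P Q⟩
      · exact ⟨(P, j ::ₘ Q), mg_cons' j P Q⟩

noncomputable def mgE : Multiset ι × Multiset J ≃ Multiset (ι ⊕ₗ J) :=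
  Equiv.ofBijective _ mg_bij

/-- slice embedding -/
noncomputable def T (K : Type u) [Field K] {ι J : Type u} [LinearOrder ι] [LinearOrder J]
    (Q : Multiset J) : (Multiset ι →₀ K) →ₗ[K] (Multiset (ι ⊕ₗ J) →₀ K) :=
  Finsupp.lmapDomain K K (fun P => mg P Q)

lemma T_z (P : Multiset ι) (Q : Multiset J) : T K Q (z K P) = z K (mg P Q) := by
  simp [T, Finsupp.mapDomain_single]

lemma compare (bA : Module.Basis (ι ⊕ₗ J) K A) (bB : Module.Basis ι K B) (g : B →ₗ⁅K⁆ A)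
    (hg : ∀ i, bA (Sum.inlₗ i) = g (bB i)) (Q : Multiset J) (n : ℕ) :
    ∀ (P : Multiset ι), P.card < n → ∀ x,
      F bA (g x) (T K Q (z K P)) = T K Q (F bB x (z K P)) := by
  induction n with
  | zero => simp
  | succ n ih =>
    intro P hP x
    suffices h : (F bA).flip (T K Q (z K P)) ∘ₗ (g : B →ₗ[K] A)
        = T K Q ∘ₗ (F bB).flip (z K P) from LinearMap.congr_fun h x
    apply bB.ext
    intro i
    simp only [LinearMap.comp_apply, LinearMap.flip_apply, LieHom.coe_toLinearMap]
    by_cases hi : ∀ k ∈ P, i ≤ k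
    · rw [F_le _ _ _ hi, T_z, T_z, ← hg, F_le _ _ _ (mg_le i P Q hi), mg_cons]
    · have h0 : P ≠ 0 := by rintro rfl; simp at hi
      obtain ⟨j, N, rfl, hj⟩ := exists_min_cons P h0
      have hij : j < i := by
        push Not at hi
        obtain ⟨k, hk, hki⟩ := hi
        rcases Multiset.mem_cons.1 hk with rfl | hk
        · exact hki
        · exact (hj k hk).trans_lt hki
      have hN : N.card < n := by simpa using hP
      have ihV := V_eq (F bA (g (bB j)) ∘ₗ T K Q) (T K Q ∘ₗ F bB (bB j))
        (fun M hM => ih M (hM.trans_lt hN) _) _ (F_deg bB i N)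
      simp only [LinearMap.comp_apply] at ihV
      rw [F_lt' bB i j N hj hij, map_add, map_add, ← ihV, ← ih N hN, map_sub, ← ih N hN]
      simp only [T_z, mg_cons, ← hg, LieHom.map_lie]
      rw [F_lt' bA _ _ _ (mg_le j N Q hj) (Sum.Lex.inl_lt_inl_iff.2 hij)]

lemma compare' (bA : Module.Basis (ι ⊕ₗ J) K A) (bB : Module.Basis ι K B) (g : B →ₗ⁅K⁆ A)
    (hg : ∀ i, bA (Sum.inlₗ i) = g (bB i)) (Q : Multiset J) (P : Multiset ι) (x : B) :
      F bA (g x) (z K (mg P Q)) = (F bB x (z K P)).mapDomain (fun P => mg P Q) := by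
  rw [← T_z, compare bA bB g hg Q _ P (Nat.lt_succ_self _)]
  rfl

end rel

section inert
variable {K : Type u} [Field K] {X S Y : Type u}

noncomputable def inert (e : X × S ≃ Y) :
    ((X →₀ K) →ₗ[K] (X →₀ K)) →ₗ[K] ((Y →₀ K) →ₗ[K] (Y →₀ K)) where
  toFun φ := Finsupp.linearCombination K
    (fun y => (φ (Finsupp.single (e.symm y).1 1)).mapDomain (fun p => e (p, (e.symm y).2)))
  map_add' φ ψ := by
    refine Finsupp.lhom_ext' fun M => LinearMap.ext_ring ?_
    simp [Finsupp.mapDomain_add]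
  map_smul' c φ := by
    refine Finsupp.lhom_ext' fun M => LinearMap.ext_ring ?_
    simp [Finsupp.mapDomain_smul]

lemma inert_apply (e : X × S ≃ Y) (φ : (X →₀ K) →ₗ[K] (X →₀ K)) (t : S) (v : X →₀ K) :
    inert e φ (v.mapDomain (fun p => e (p, t))) = (φ v).mapDomain (fun p => e (p, t)) := by
  suffices h : inert e φ ∘ₗ Finsupp.lmapDomain K K (fun p => e (p, t)) =
    Finsupp.lmapDomain K K (fun p => e (p, t)) ∘ₗ φ from LinearMap.congr_fun h v
  refine Finsupp.lhom_ext' fun M => LinearMap.ext_ring ?_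
  simp [inert, Finsupp.mapDomain_single]

lemma inert_single (e : X × S ≃ Y) (φ : (X →₀ K) →ₗ[K] (X →₀ K)) (t : S) (p : X) :
    inert e φ (Finsupp.single (e (p, t)) 1)
      = (φ (Finsupp.single p 1)).mapDomain (fun p => e (p, t)) := by
  rw [← inert_apply, Finsupp.mapDomain_single]

lemma inert_mul (e : X × S ≃ Y) (φ ψ : (X →₀ K) →ₗ[K] (X →₀ K)) :
    inert e (φ ∘ₗ ψ) = inert e φ ∘ₗ inert e ψ := by
  refine Finsupp.lhom_ext' fun y => LinearMap.ext_ring ?_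
  obtain ⟨⟨p, t⟩, rfl⟩ := e.surjective y
  simp only [LinearMap.comp_apply, Finsupp.lsingle_apply, inert_single, inert_apply]

end inert

lemma exists_basis {K : Type u} [Field K] {A B : Type u} [LieRing A] [LieAlgebra K A]
    [LieRing B] [LieAlgebra K B] {ι : Type u} (bB : Module.Basis ι K B) (g : B →ₗ⁅K⁆ A)
    (hg : Function.Injective g) :
    ∃ (J : Type u) (bA : Module.Basis (ι ⊕ₗ J) K A), ∀ i, bA (Sum.inlₗ i) = g (bB i) := by
  have hl : LinearIndependent K (fun i => g (bB i)) :=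
    bB.linearIndependent.map' (g : B →ₗ[K] A) (LinearMap.ker_eq_bot.2 hg)
  refine ⟨_, (Module.Basis.sumExtend hl).reindex toLex, fun i => ?_⟩
  simp only [Module.Basis.reindex_apply, Module.Basis.sumExtend]
  erw [Equiv.symm_symm]
  simp only [Module.Basis.extend_apply_self]
  rfl

lemma exists_linOrder (ι : Type u) : Nonempty (LinearOrder ι) :=
  ⟨linearOrderOfSTO WellOrderingRel⟩

lemma inert_lie {K : Type u} [Field K] {L : Type u} [LieRing L] [LieAlgebra K L]
    {ι S Y : Type u} [LinearOrder ι] (b : Module.Basis ι K L) (e : Multiset ι × S ≃ Y) (x y : L) :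
    inert e (F b ⁅x, y⁆) = inert e (F b x) ∘ₗ inert e (F b y)
      - inert e (F b y) ∘ₗ inert e (F b x) := by
  have h : F b x ∘ₗ F b y = F b y ∘ₗ F b x + F b ⁅x, y⁆ :=
    LinearMap.ext fun v => F_rep b x y v
  have h2 := congrArg (inert e) h
  rw [map_add, inert_mul, inert_mul] at h2
  rw [h2]
  refine LinearMap.ext fun v => ?_
  rw [LinearMap.sub_apply, LinearMap.add_apply, add_sub_cancel_left]

attribute [local instance] LieRing.ofAssociativeRing

noncomputable def repHom {K : Type u} [Field K] {L : Type u} [LieRing L] [LieAlgebra K L]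
    {ι S Y : Type u} [LinearOrder ι] (b : Module.Basis ι K L) (e : Multiset ι × S ≃ Y) :
    L →ₗ⁅K⁆ Module.End K (Y →₀ K) :=
  { inert e ∘ₗ F b with
    map_lie' := by
      intro x y
      exact inert_lie b e x y }

lemma repHom_single {K : Type u} [Field K] {L : Type u} [LieRing L] [LieAlgebra K L]
    {ι S Y : Type u} [LinearOrder ι] (b : Module.Basis ι K L) (e : Multiset ι × S ≃ Y)
    (x : L) (p : Multiset ι) (t : S) :
    repHom b e x (Finsupp.single (e (p, t)) 1) = (F b x (z K p)).mapDomain (fun p => e (p, t)) :=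
  inert_single e (F b x) t p

lemma repHom_zero {K : Type u} [Field K] {L : Type u} [LieRing L] [LieAlgebra K L]
    {ι S Y : Type u} [LinearOrder ι] (b : Module.Basis ι K L) (e : Multiset ι × S ≃ Y)
    (x : L) (t : S) :
    repHom b e x (Finsupp.single (e (0, t)) 1) =
      (b.repr x).mapDomain (fun i => e ({i}, t)) := by
  rw [repHom_single, F_zero, ← Finsupp.mapDomain_comp]
  rfl

lemma sl_inj {ι S Y : Type u} (e : Multiset ι × S ≃ Y) (t : S) :
    Function.Injective (fun i : ι => e ({i}, t)) := by
  intro i j h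
  simpa using h

lemma repHom_inj {K : Type u} [Field K] {L : Type u} [LieRing L] [LieAlgebra K L]
    {ι S Y : Type u} [LinearOrder ι] (b : Module.Basis ι K L) (e : Multiset ι × S ≃ Y) (t : S) :
    Function.Injective (repHom b e) := by
  intro x y h
  have h1 := LinearMap.congr_fun h (Finsupp.single (e (0, t)) 1)
  rw [repHom_zero, repHom_zero] at h1
  exact b.repr.injective (Finsupp.mapDomain_injective (sl_inj e t) h1)

theorem exists_amalgam_aux {K : Type u} [Field K] {A B C : Type u} [LieRing A] [LieAlgebra K A]
    [LieRing B] [LieAlgebra K B] [LieRing C] [LieAlgebra K C] (g0 : B →ₗ⁅K⁆ A) (g1 : B →ₗ⁅K⁆ C)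
    {ι JA JC : Type u} [LinearOrder ι] [LinearOrder JA] [LinearOrder JC]
    (bB : Module.Basis ι K B) (bA : Module.Basis (ι ⊕ₗ JA) K A) (bC : Module.Basis (ι ⊕ₗ JC) K C)
    (hA : ∀ i, bA (Sum.inlₗ i) = g0 (bB i)) (hC : ∀ i, bC (Sum.inlₗ i) = g1 (bB i)) :
    ∃ (Q : Type u) (_ : LieRing Q) (_ : LieAlgebra K Q) (i : A →ₗ⁅K⁆ Q) (j : C →ₗ⁅K⁆ Q),
      i.comp g0 = j.comp g1 ∧ Function.Injective i ∧ Function.Injective j ∧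
      ∀ a c, i a = j c → a ∈ Set.range g0 := by
  let eA : Multiset (ι ⊕ₗ JA) × Multiset JC ≃ (Multiset ι × Multiset JA) × Multiset JC :=
    Equiv.prodCongr mgE.symm (Equiv.refl _)
  let eC : Multiset (ι ⊕ₗ JC) × Multiset JA ≃ (Multiset ι × Multiset JA) × Multiset JC :=
    (Equiv.prodCongr mgE.symm (Equiv.refl _)).trans
      ⟨fun p => ((p.1.1, p.2), p.1.2), fun p => ((p.1.1, p.2), p.1.2), fun _ => rfl, fun _ => rfl⟩
  have eA_mg : ∀ P Q R, eA (mg P Q, R) = ((P, Q), R) := by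
    intro P Q R
    have : mgE.symm (mg P Q) = (P, Q) := by rw [Equiv.symm_apply_eq]; rfl
    simp [eA, this]
  have eC_mg : ∀ P Q R, eC (mg P R, Q) = ((P, Q), R) := by
    intro P Q R
    have : mgE.symm (mg P R) = (P, R) := by rw [Equiv.symm_apply_eq]; rfl
    simp [eC, this]
  refine ⟨Module.End K (((Multiset ι × Multiset JA) × Multiset JC) →₀ K), inferInstance,
    inferInstance, repHom bA eA, repHom bC eC, ?_, repHom_inj _ _ 0, repHom_inj _ _ 0, ?_⟩
  · ext1 b
    refine Finsupp.lhom_ext' fun y => LinearMap.ext_ring ?_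
    obtain ⟨⟨P, Q⟩, R⟩ := y
    simp only [LieHom.comp_apply, LinearMap.comp_apply, Finsupp.lsingle_apply]
    conv_lhs => rw [← eA_mg P Q R]
    conv_rhs => rw [← eC_mg P Q R]
    rw [repHom_single, repHom_single, compare' bA bB g0 hA, compare' bC bB g1 hC,
      ← Finsupp.mapDomain_comp, ← Finsupp.mapDomain_comp]
    congr 1
    ext1 P'
    simp only [Function.comp_apply, eA_mg, eC_mg]
  · intro a c h
    have h1 := LinearMap.congr_fun h (Finsupp.single ((0, 0), 0) 1)
    have z1 : (mg (0 : Multiset ι) (0 : Multiset JA)) = 0 := by simp [mg]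
    have z2 : (mg (0 : Multiset ι) (0 : Multiset JC)) = 0 := by simp [mg]
    have a1 := eA_mg 0 0 0
    have c1 := eC_mg 0 0 0
    rw [z1] at a1
    rw [z2] at c1
    conv_lhs at h1 => rw [← a1]
    conv_rhs at h1 => rw [← c1]
    rw [repHom_zero, repHom_zero] at h1
    have h2 : ∀ j : JA, bA.repr a (Sum.inrₗ j) = 0 := by
      intro j
      have h3 := DFunLike.congr_fun h1 (eA ({Sum.inrₗ j}, 0))
      rw [Finsupp.mapDomain_apply (sl_inj eA 0)] at h3
      rw [h3]
      apply Finsupp.mapDomain_of_notMem_range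
      rintro ⟨k, hk⟩
      have e1 : ({Sum.inrₗ j} : Multiset (ι ⊕ₗ JA)) = mg 0 {j} := by simp [mg]
      rw [e1, eA_mg] at hk
      have h4 : (eC ({k}, 0)).1.2 = 0 := rfl
      simp only at hk
      rw [hk] at h4
      simp at h4
    have h5 : a ∈ Submodule.span K (bA '' (bA.repr a).support) := bA.mem_span_repr_support a
    have h6 : Submodule.span K (bA '' (bA.repr a).support) ≤ LinearMap.range (g0 : B →ₗ[K] A) := by
      rw [Submodule.span_le]
      rintro _ ⟨k, hk, rfl⟩
      obtain ⟨k, rfl⟩ := toLex.surjective k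
      rcases k with i | j
      · exact ⟨bB i, (hA i).symm⟩
      · exact absurd (h2 j) (by simpa using hk)
    exact h6 h5

theorem exists_amalgam {K : Type u} [Field K] {A B C : Type u} [LieRing A] [LieAlgebra K A]
    [LieRing B] [LieAlgebra K B] [LieRing C] [LieAlgebra K C] (g0 : B →ₗ⁅K⁆ A) (g1 : B →ₗ⁅K⁆ C)
    (hg0 : Function.Injective g0) (hg1 : Function.Injective g1) :
    ∃ (Q : Type u) (_ : LieRing Q) (_ : LieAlgebra K Q) (i : A →ₗ⁅K⁆ Q) (j : C →ₗ⁅K⁆ Q),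
      i.comp g0 = j.comp g1 ∧ Function.Injective i ∧ Function.Injective j ∧
      ∀ a c, i a = j c → a ∈ Set.range g0 := by
  obtain ⟨o1⟩ := exists_linOrder (Module.Basis.ofVectorSpaceIndex K B)
  obtain ⟨JA, bA, hA⟩ := exists_basis (Module.Basis.ofVectorSpace K B) g0 hg0
  obtain ⟨JC, bC, hC⟩ := exists_basis (Module.Basis.ofVectorSpace K B) g1 hg1
  obtain ⟨o2⟩ := exists_linOrder JA
  obtain ⟨o3⟩ := exists_linOrder JC
  exact exists_amalgam_aux g0 g1 _ bA bC hA hC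

end PBW

theorem exists_lie_pushout {K : Type u} [Field K] {A B C : Type u} [LieRing A] [LieAlgebra K A]
    [LieRing B] [LieAlgebra K B] [LieRing C] [LieAlgebra K C] (g0 : B →ₗ⁅K⁆ A) (g1 : B →ₗ⁅K⁆ C) :
    ∃ (P : Type u) (_ : LieRing P) (_ : LieAlgebra K P) (i : A →ₗ⁅K⁆ P) (j : C →ₗ⁅K⁆ P),
      i.comp g0 = j.comp g1 ∧
      ∀ (E : Type u) [LieRing E] [LieAlgebra K E] (f : A →ₗ⁅K⁆ E) (g : C →ₗ⁅K⁆ E),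
        f.comp g0 = g.comp g1 → ∃ h : P →ₗ⁅K⁆ E, h.comp i = f ∧ h.comp j = g := by
  let I : LieIdeal K (FreeLieAlgebra K (A ⊕ C)) :=
    sInf {J | ∃ (E : Type u) (_ : LieRing E) (_ : LieAlgebra K E) (f : A →ₗ⁅K⁆ E) (g : C →ₗ⁅K⁆ E),
      f.comp g0 = g.comp g1 ∧ J = (FreeLieAlgebra.lift K (Sum.elim f g)).ker}
  have hI : ∀ x, x ∈ I ↔ ∀ (E : Type u) (_ : LieRing E) (_ : LieAlgebra K E) (f : A →ₗ⁅K⁆ E)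
      (g : C →ₗ⁅K⁆ E), f.comp g0 = g.comp g1 → FreeLieAlgebra.lift K (Sum.elim f g) x = 0 := by
    intro x
    rw [← SetLike.mem_coe, LieSubmodule.coe_sInf]
    simp only [Set.mem_iInter, SetLike.mem_coe]
    constructor
    · intro h E _ _ f g hfg
      exact LieHom.mem_ker.1 (h _ ⟨E, _, _, f, g, hfg, rfl⟩)
    · rintro h _ ⟨E, _, _, f, g, hfg, rfl⟩
      exact LieHom.mem_ker.2 (h E _ _ f g hfg)
  let m : FreeLieAlgebra K (A ⊕ C) →ₗ[K] (FreeLieAlgebra K (A ⊕ C) ⧸ I) := I.toSubmodule.mkQ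
  have hm : ∀ x y, m x = m y ↔ x - y ∈ I := fun x y => Submodule.Quotient.eq _
  have hml : ∀ x y, m ⁅x, y⁆ = ⁅m x, m y⁆ := fun x y => LieSubmodule.Quotient.mk_bracket _ x y
  refine ⟨FreeLieAlgebra K (A ⊕ C) ⧸ I, inferInstance, inferInstance,
    { toFun := fun a => m (FreeLieAlgebra.of K (Sum.inl a))
      map_add' := ?_, map_smul' := ?_, map_lie' := ?_ },
    { toFun := fun a => m (FreeLieAlgebra.of K (Sum.inr a))
      map_add' := ?_, map_smul' := ?_, map_lie' := ?_ }, ?_, ?_⟩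
  · intro x y
    rw [← map_add, hm, hI]
    intros
    simp
  · intro x y
    rw [RingHom.id_apply, ← map_smul, hm, hI]
    intros
    simp
  · intro x y
    rw [← hml, hm, hI]
    intros
    simp
  · intro x y
    rw [← map_add, hm, hI]
    intros
    simp
  · intro x y
    rw [RingHom.id_apply, ← map_smul, hm, hI]
    intros
    simp
  · intro x y
    rw [← hml, hm, hI]
    intros
    simp
  · ext1 b
    change m _ = m _
    rw [hm, hI]
    intro E _ _ f g h
    have := LieHom.congr_fun h b
    simp only [LieHom.comp_apply] at this
    simp [this]
  · intro E _ _ f g h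
    refine ⟨{ I.toSubmodule.liftQ (FreeLieAlgebra.lift K (Sum.elim f g) :
        FreeLieAlgebra K (A ⊕ C) →ₗ[K] E) ?_ with map_lie' := ?_ }, ?_, ?_⟩
    · intro x hx
      exact (hI x).1 hx E _ _ f g h
    · intro x y
      obtain ⟨x, rfl⟩ := Submodule.mkQ_surjective _ x
      obtain ⟨y, rfl⟩ := Submodule.mkQ_surjective _ y
      exact LieHom.map_lie (FreeLieAlgebra.lift K (Sum.elim f g)) x y
    · ext1 a
      exact FreeLieAlgebra.lift_of_apply (Sum.elim f g) (Sum.inl a)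
    · ext1 a
      exact FreeLieAlgebra.lift_of_apply (Sum.elim f g) (Sum.inr a)

namespace GrAm
open Finset

section Tr
variable {K : Type u} [Field K] {P : Type u} [LieRing P] [LieAlgebra K P]

/-- `P`-valued sequences, with convolution bracket truncated above `c` -/
def Tr (_ : ℕ) (P : Type u) : Type u := ℕ → P

variable {c : ℕ}
instance : AddCommGroup (Tr c P) := inferInstanceAs (AddCommGroup (ℕ → P))
instance : Module K (Tr c P) := inferInstanceAs (Module K (ℕ → P))

def Tr.br (x y : Tr c P) : Tr c P :=
  fun n => if n ≤ c then ∑ p ∈ antidiagonal n, ⁅x p.1, y p.2⁆ else 0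

lemma Tr.br_le (x y : Tr c P) {n : ℕ} (h : n ≤ c) :
    Tr.br x y n = ∑ p ∈ antidiagonal n, ⁅x p.1, y p.2⁆ := if_pos h

lemma Tr.br_gt (x y : Tr c P) {n : ℕ} (h : ¬ n ≤ c) : Tr.br x y n = 0 := if_neg h

def Tr.mk (f : ℕ → P) : Tr c P := f
lemma Tr.mk_app (f : ℕ → P) (n : ℕ) : (Tr.mk f : Tr c P) n = f n := rfl
lemma Tr.ext' {x y : Tr c P} (h : ∀ n, x n = y n) : x = y := funext h

lemma Tr.add_app (x y : Tr c P) (n : ℕ) : (x + y) n = x n + y n := rfl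
lemma Tr.zero_app (n : ℕ) : (0 : Tr c P) n = 0 := rfl
lemma Tr.smul_app (k : K) (x : Tr c P) (n : ℕ) : (k • x) n = k • x n := rfl

instance : LieRing (Tr c P) where
  bracket := Tr.br
  add_lie x y w := by
    funext n
    rw [Tr.add_app]
    by_cases h : n ≤ c
    · simp [Tr.br_le _ _ h, Tr.add_app, sum_add_distrib]
    · simp [Tr.br_gt _ _ h]
  lie_add x y w := by
    funext n
    rw [Tr.add_app]
    by_cases h : n ≤ c
    · simp [Tr.br_le _ _ h, Tr.add_app, sum_add_distrib]
    · simp [Tr.br_gt _ _ h]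
  lie_self x := by
    funext n
    change Tr.br _ _ n = 0
    by_cases h : n ≤ c
    · rw [Tr.br_le _ _ h]
      refine sum_involution (fun p _ => p.swap) ?_ ?_ ?_ ?_
      · intro p _
        simp only [Prod.fst_swap, Prod.snd_swap]
        rw [← lie_skew, neg_add_cancel]
      · rintro ⟨i, j⟩ _ hne heq
        simp only [Prod.swap_prod_mk, Prod.mk.injEq] at heq
        obtain ⟨rfl, _⟩ := heq
        simp at hne
      · intro p hp
        simpa [add_comm] using hp
      · intro p _
        simp
    · simp [Tr.br_gt _ _ h]
  leibniz_lie x y w := by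
    funext n
    rw [Tr.add_app]
    by_cases h : n ≤ c
    · have e1 : ∀ x y w : Tr c P, Tr.br x (Tr.br y w) n = ∑ p ∈ antidiagonal n,
          ∑ q ∈ antidiagonal p.2, ⁅x p.1, ⁅y q.1, w q.2⁆⁆ := by
        intro x y w
        rw [Tr.br_le _ _ h]
        refine sum_congr rfl fun p hp => ?_
        rw [Tr.br_le _ _ (by have := HasAntidiagonal.mem_antidiagonal.1 hp; omega), lie_sum]
      have e2 : Tr.br (Tr.br x y) w n = ∑ p ∈ antidiagonal n,
          ∑ q ∈ antidiagonal p.2, ⁅⁅x p.1, y q.1⁆, w q.2⁆ := by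
        rw [Tr.br_le _ _ h]
        rw [sum_congr rfl (g := fun p => ∑ q ∈ antidiagonal p.1, ⁅⁅x q.1, y q.2⁆, w p.2⁆)
          (fun p hp => by rw [Tr.br_le _ _ (by have := HasAntidiagonal.mem_antidiagonal.1 hp; omega), sum_lie])]
        rw [sum_sigma', sum_sigma']
        refine sum_bij' (fun p _ => ⟨(p.2.1, p.2.2 + p.1.2), (p.2.2, p.1.2)⟩)
          (fun p _ => ⟨(p.1.1 + p.2.1, p.2.2), (p.1.1, p.2.1)⟩) ?_ ?_ ?_ ?_ ?_
        all_goals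
          rintro ⟨⟨a, b⟩, ⟨d, e⟩⟩ hp
          simp only [mem_sigma, HasAntidiagonal.mem_antidiagonal] at hp
          obtain ⟨h1, h2⟩ := hp
          subst h2
          subst h1
        all_goals simp [add_assoc]
      have e3 : Tr.br y (Tr.br x w) n = ∑ p ∈ antidiagonal n,
          ∑ q ∈ antidiagonal p.2, ⁅y q.1, ⁅x p.1, w q.2⁆⁆ := by
        rw [e1, sum_sigma', sum_sigma']
        refine sum_bij' (fun p _ => ⟨(p.2.1, p.1.1 + p.2.2), (p.1.1, p.2.2)⟩)
          (fun p _ => ⟨(p.2.1, p.1.1 + p.2.2), (p.1.1, p.2.2)⟩) ?_ ?_ ?_ ?_ ?_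
        all_goals
          rintro ⟨⟨a, b⟩, ⟨d, e⟩⟩ hp
          simp only [mem_sigma, HasAntidiagonal.mem_antidiagonal] at hp
          obtain ⟨h1, h2⟩ := hp
          subst h2
          subst h1
        all_goals simp [add_left_comm]
      rw [e1, e2, e3, ← sum_add_distrib]
      refine sum_congr rfl fun p hp => ?_
      rw [← sum_add_distrib]
      refine sum_congr rfl fun q hq => ?_
      rw [leibniz_lie]
    · simp [Tr.br_gt _ _ h]

lemma Tr.lie_le (x y : Tr c P) {n : ℕ} (h : n ≤ c) :
    ⁅x, y⁆ n = ∑ p ∈ antidiagonal n, ⁅x p.1, y p.2⁆ := if_pos h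

lemma Tr.lie_gt (x y : Tr c P) {n : ℕ} (h : ¬ n ≤ c) : ⁅x, y⁆ n = 0 := if_neg h

instance : LieAlgebra K (Tr c P) where
  lie_smul k x y := by
    funext n
    rw [Tr.smul_app]
    by_cases h : n ≤ c
    · simp [Tr.lie_le _ _ h, Tr.smul_app, smul_sum]
    · simp [Tr.lie_gt _ _ h]

end Tr
end GrAm
namespace GrAm
open Finset

section Pi
variable {K : Type u} [Field K] {c : ℕ}

noncomputable def dec (A : CNilpGradedLieAlg K c) : DirectSum ℕ (fun i => A.piece i) ≃ₗ[K] A :=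
  LinearEquiv.ofBijective (DirectSum.coeLinearMap A.piece) A.isInternal

noncomputable def pr (A : CNilpGradedLieAlg K c) (n : ℕ) : A →ₗ[K] A :=
  (A.piece n).subtype ∘ₗ DirectSum.component K ℕ (fun i => A.piece i) n ∘ₗ (dec A).symm.toLinearMap

variable (A : CNilpGradedLieAlg K c)

lemma pr_mem (n : ℕ) (a : A) : pr A n a ∈ A.piece n := Subtype.prop _

lemma dec_symm {n : ℕ} {a : A} (h : a ∈ A.piece n) :
    (dec A).symm a = DirectSum.lof K ℕ (fun i => A.piece i) n ⟨a, h⟩ := by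
  rw [LinearEquiv.symm_apply_eq]
  exact (DirectSum.coeLinearMap_lof A.piece n ⟨a, h⟩).symm

lemma pr_same {n : ℕ} {a : A} (h : a ∈ A.piece n) : pr A n a = a := by
  simp [pr, dec_symm A h, DirectSum.component.lof_self]

lemma pr_ne {n m : ℕ} {a : A} (h : a ∈ A.piece m) (hm : m ≠ n) : pr A n a = 0 := by
  simp only [pr, LinearMap.comp_apply, LinearEquiv.coe_coe, dec_symm A h]
  rw [DirectSum.component.of, dif_neg hm]
  simp

lemma pr_if (n m : ℕ) {a : A} (h : a ∈ A.piece m) : pr A n a = if m = n then a else 0 := by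
  split_ifs with hm
  · subst hm
    exact pr_same A h
  · exact pr_ne A h hm

lemma pr_gt {n : ℕ} (h : c < n) (a : A) : pr A n a = 0 := by
  have := pr_mem A n a
  rwa [A.piece_of_gt n h, Submodule.mem_bot] at this

lemma pr_zero (a : A) : pr A 0 a = 0 := by
  have := pr_mem A 0 a
  rwa [A.piece_zero, Submodule.mem_bot] at this

lemma pr_ind {p : A → Prop} (h1 : ∀ n a, a ∈ A.piece n → p a) (h0 : p 0)
    (hadd : ∀ a b, p a → p b → p (a + b)) (a : A) : p a := by
  have ha : a ∈ ⨆ i, A.piece i := by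
    rw [A.isInternal.submodule_iSup_eq_top]; trivial
  exact Submodule.iSup_induction _ (motive := p) ha h1 h0 hadd

lemma sum_pr (a : A) : ∑ n ∈ range (c + 1), pr A n a = a := by
  induction a using pr_ind with
  | h1 m a h =>
    rw [sum_congr rfl (fun n _ => pr_if A n m h)]
    by_cases hm : m < c + 1
    · simp [hm]
    · rw [A.piece_of_gt m (by omega), Submodule.mem_bot] at h
      simp [h]
  | h0 => simp
  | hadd a b ha hb => simp [sum_add_distrib, ha, hb]

lemma pr_ext {a b : A} (h : ∀ n, pr A n a = pr A n b) : a = b := by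
  rw [← sum_pr A a, ← sum_pr A b]
  exact sum_congr rfl fun n _ => h n

lemma pr_lie (n : ℕ) (a b : A) :
    pr A n ⁅a, b⁆ = ∑ p ∈ antidiagonal n, ⁅pr A p.1 a, pr A p.2 b⁆ := by
  induction a using pr_ind with
  | h1 i a ha =>
    induction b using pr_ind with
    | h1 j b hb =>
      rw [pr_if A n (i + j) (A.lie_mem i j a b ha hb),
        sum_congr rfl (fun p _ => by rw [pr_if A p.1 i ha, pr_if A p.2 j hb])]
      split_ifs with hn
      · rw [sum_eq_single (i, j)]
        · simp
        · rintro ⟨k, l⟩ _ hne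
          by_cases h1 : i = k
          · by_cases h2 : j = l
            · subst h1 h2; exact absurd rfl hne
            · simp [h2]
          · simp [h1]
        · intro h
          exact absurd (HasAntidiagonal.mem_antidiagonal.2 hn) h
      · symm
        refine sum_eq_zero ?_
        rintro ⟨k, l⟩ hp
        have hp := HasAntidiagonal.mem_antidiagonal.1 hp
        by_cases h1 : i = k
        · by_cases h2 : j = l
          · subst h1 h2; exact absurd hp hn
          · simp [h2]
        · simp [h1]
    | h0 => simp
    | hadd x y hx hy => simp [hx, hy, sum_add_distrib]
  | h0 => simp
  | hadd x y hx hy => simp [hx, hy, sum_add_distrib]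

variable {A}
lemma pr_hom {B : CNilpGradedLieAlg K c} (f : A →ₗ⁅K⁆ B) (hf : LieHomIsGraded A B f) (n : ℕ)
    (a : A) : pr B n (f a) = f (pr A n a) := by
  induction a using pr_ind with
  | h1 m a h =>
    rw [pr_if B n m (hf m a h), pr_if A n m h]
    split_ifs <;> simp
  | h0 => simp
  | hadd a b ha hb => simp [ha, hb]

variable {P : Type u} [LieRing P] [LieAlgebra K P]

noncomputable def phi (i : A →ₗ⁅K⁆ P) : A →ₗ⁅K⁆ Tr c P where
  toFun a := Tr.mk fun n => i (pr A n a)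
  map_add' a b := by
    refine Tr.ext' fun n => ?_
    simp only [Tr.add_app, Tr.mk_app, map_add]
  map_smul' k a := by
    refine Tr.ext' fun n => ?_
    simp only [Tr.smul_app, Tr.mk_app, map_smul, RingHom.id_apply]
  map_lie' {a b} := by
    refine Tr.ext' fun n => ?_
    by_cases h : n ≤ c
    · rw [Tr.lie_le _ _ h]
      simp [pr_lie, Tr.mk_app]
    · rw [Tr.lie_gt _ _ h, Tr.mk_app, pr_gt A (by omega)]
      simp

lemma phi_app (i : A →ₗ⁅K⁆ P) (a : A) (n : ℕ) : phi i a n = i (pr A n a) := rfl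

end Pi

section D
variable {K : Type u} [Field K] {c : ℕ} {P : Type u} [LieRing P] [LieAlgebra K P]

def sg (n : ℕ) : P →ₗ[K] Tr c P where
  toFun x := Tr.mk fun m => if m = n then x else 0
  map_add' x y := by
    refine Tr.ext' fun m => ?_
    simp only [Tr.add_app, Tr.mk_app]
    split_ifs <;> simp
  map_smul' k x := by
    refine Tr.ext' fun m => ?_
    simp only [Tr.smul_app, Tr.mk_app, RingHom.id_apply]
    split_ifs <;> simp

lemma sg_app (n m : ℕ) (x : P) : (sg (K := K) n x : Tr c P) m = if m = n then x else 0 := rfl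

lemma sg_lie (i j : ℕ) (x y : P) (h : i + j ≤ c) :
    (sg (K := K) (i + j) ⁅x, y⁆ : Tr c P) = ⁅(sg (K := K) i x : Tr c P), sg (K := K) j y⁆ := by
  refine Tr.ext' fun m => ?_
  by_cases hm : m ≤ c
  · rw [Tr.lie_le _ _ hm, sg_app]
    simp only [sg_app]
    split_ifs with hn
    · rw [sum_eq_single (i, j)]
      · simp
      · rintro ⟨k, l⟩ _ hne
        by_cases h1 : k = i
        · by_cases h2 : l = j
          · subst h1 h2; exact absurd rfl hne
          · simp [h2]
        · simp [h1]
      · intro h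
        exact absurd (HasAntidiagonal.mem_antidiagonal.2 hn.symm) h
    · symm
      refine sum_eq_zero ?_
      rintro ⟨k, l⟩ hp
      have hp := HasAntidiagonal.mem_antidiagonal.1 hp
      by_cases h1 : k = i
      · by_cases h2 : l = j
        · subst h1 h2; exact absurd hp.symm hn
        · simp [h2]
      · simp [h1]
  · rw [Tr.lie_gt _ _ hm, sg_app, if_neg (by omega)]

def cmp (n : ℕ) (x : Tr c P) : Tr c P := sg (K := K) n (x n)

lemma cmp_app (n m : ℕ) (x : Tr c P) :
    cmp (K := K) n x m = if m = n then x n else 0 := rfl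

def ev (n : ℕ) : Tr c P →ₗ[K] P where
  toFun x := x n
  map_add' x y := rfl
  map_smul' k x := rfl

lemma ev_app (n : ℕ) (x : Tr c P) : ev (K := K) n x = x n := rfl

lemma sum_app {ι : Type*} (s : Finset ι) (f : ι → Tr c P) (n : ℕ) :
    (∑ i ∈ s, f i) n = ∑ i ∈ s, f i n := Finset.sum_apply n s f

def good (c : ℕ) (V : ℕ → Submodule K P)
    (hV : ∀ i j x y, x ∈ V i → y ∈ V j → i + j ≤ c → ⁅x, y⁆ ∈ V (i + j)) :
    LieSubalgebra K (Tr c P) where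
  carrier := {x | ∀ n, x n ∈ V n}
  add_mem' hx hy n := (V n).add_mem (hx n) (hy n)
  zero_mem' n := (V n).zero_mem
  smul_mem' k x hx n := (V n).smul_mem k (hx n)
  lie_mem' {x y} hx hy n := by
    by_cases h : n ≤ c
    · rw [Tr.lie_le _ _ h]
      refine Submodule.sum_mem _ fun p hp => ?_
      have hp := HasAntidiagonal.mem_antidiagonal.1 hp
      have := hV p.1 p.2 _ _ (hx p.1) (hy p.2) (by omega)
      rwa [hp] at this
    · rw [Tr.lie_gt _ _ h]
      exact (V n).zero_mem

variable (D : LieSubalgebra K (Tr c P))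

/-- A graded subalgebra of `Tr c P` concentrated in degrees `1, ..., c` -/
structure IsGr : Prop where
  zero : ∀ x ∈ D, x 0 = 0
  gt : ∀ x ∈ D, ∀ n, c < n → x n = 0
  comp : ∀ x ∈ D, ∀ n, cmp (K := K) n x ∈ D

def pc (n : ℕ) : Submodule K D where
  carrier := {x | ∀ m, m ≠ n → x.1 m = 0}
  add_mem' {x y} hx hy m hm := by
    change x.1 m + y.1 m = 0
    rw [hx m hm, hy m hm, add_zero]
  zero_mem' m _ := rfl
  smul_mem' k x hx m hm := by
    change k • x.1 m = 0
    rw [hx m hm, smul_zero]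

lemma mem_pc {n : ℕ} {x : D} : x ∈ pc D n ↔ ∀ m, m ≠ n → x.1 m = 0 := Iff.rfl

lemma coe_pc (d : DirectSum ℕ (fun i => pc D i)) (n : ℕ) :
    (DirectSum.coeLinearMap (pc D) d).1 n = (d n).1.1 n := by
  induction d using DirectSum.induction_on with
  | zero => rfl
  | of i x =>
    rw [DirectSum.coeLinearMap_of, DirectSum.of_apply]
    split_ifs with h
    · subst h; rfl
    · exact x.2 n (Ne.symm h)
  | add x y hx hy =>
    rw [map_add, DirectSum.add_apply]
    change (DirectSum.coeLinearMap (pc D) x).1 n + (DirectSum.coeLinearMap (pc D) y).1 n =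
      (x n).1.1 n + (y n).1.1 n
    rw [hx, hy]

lemma sum_cmp (x : Tr c P) (hx : ∀ n, c < n → x n = 0) :
    ∑ n ∈ range (c + 1), cmp (K := K) n x = x := by
  funext m
  rw [sum_app]
  simp only [cmp_app]
  by_cases h : m < c + 1
  · rw [sum_eq_single m]
    · simp
    · intro b _ hb; simp [Ne.symm hb]
    · intro h'; simp at h'; omega
  · rw [hx m (by omega)]
    refine sum_eq_zero fun n hn => ?_
    rw [mem_range] at hn
    rw [if_neg (by omega)]

lemma internal (hD : IsGr D) : DirectSum.IsInternal (pc D) := by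
  constructor
  · intro d e h
    refine DirectSum.ext_iff.2 fun n => ?_
    refine Subtype.ext (Subtype.ext ?_)
    funext m
    change (d n).1.1 m = (e n).1.1 m
    by_cases hm : m = n
    · subst hm
      have h : DirectSum.coeLinearMap (pc D) d = DirectSum.coeLinearMap (pc D) e := h
      rw [← coe_pc, ← coe_pc, h]
    · rw [(d n).2 m hm, (e n).2 m hm]
  · intro x
    have hc : ∀ n, (⟨cmp (K := K) n x.1, hD.comp x.1 x.2 n⟩ : D) ∈ pc D n := by
      intro n m hm
      exact if_neg hm
    refine ⟨∑ n ∈ range (c + 1), DirectSum.of (fun i => pc D i) n ⟨_, hc n⟩, ?_⟩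
    rw [map_sum]
    simp only [DirectSum.coeAddMonoidHom_of]
    refine Subtype.ext ?_
    rw [AddSubmonoidClass.coe_finsetSum]
    exact sum_cmp x.1 (hD.gt x.1 x.2)

def mkD (hD : IsGr D) : CNilpGradedLieAlg K c where
  carrier := D
  piece := pc D
  isInternal := internal D hD
  piece_zero := by
    rw [eq_bot_iff]
    intro x hx
    rw [Submodule.mem_bot]
    refine Subtype.ext (funext fun m => ?_)
    by_cases hm : m = 0
    · subst hm; exact hD.zero _ x.2
    · exact hx m hm
  piece_of_gt n hn := by
    rw [eq_bot_iff]
    intro x hx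
    rw [Submodule.mem_bot]
    refine Subtype.ext (funext fun m => ?_)
    by_cases hm : m = n
    · subst hm; exact hD.gt _ x.2 m hn
    · exact hx m hm
  lie_mem i j x y hx hy := by
    intro m hm
    change ⁅x.1, y.1⁆ m = 0
    by_cases h : m ≤ c
    · rw [Tr.lie_le _ _ h]
      refine sum_eq_zero fun p hp => ?_
      have hp := HasAntidiagonal.mem_antidiagonal.1 hp
      by_cases h1 : p.1 = i
      · rw [hy p.2 (by omega), lie_zero]
      · rw [hx p.1 h1, zero_lie]
    · rw [Tr.lie_gt _ _ h]

end D
end GrAm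
/-- the class of `c`-nilpotent graded Lie algebras over a field `K` is
closed under free amalgamation. -/
theorem cNilpGradedLieAlg_free_amalgamation (K : Type u) [Field K] (c : ℕ) (hc : 1 ≤ c)
    (A B C : CNilpGradedLieAlg K c) (g0 : B →ₗ⁅K⁆ A) (g1 : B →ₗ⁅K⁆ C)
    (hg0 : Function.Injective g0) (hg0' : LieHomIsGraded B A g0)
    (hg1 : Function.Injective g1) (hg1' : LieHomIsGraded B C g1) :
    ∃ (D : CNilpGradedLieAlg K c) (f0 : A →ₗ⁅K⁆ D) (f1 : C →ₗ⁅K⁆ D),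
      Function.Injective f0 ∧ LieHomIsGraded A D f0 ∧
      Function.Injective f1 ∧ LieHomIsGraded C D f1 ∧
      f0.comp g0 = f1.comp g1 ∧
      Set.range f0 ∩ Set.range f1 = Set.range (f0.comp g0) ∧
      LieSubalgebra.lieSpan K D (Set.range f0 ∪ Set.range f1) = ⊤ ∧
      ∀ (E : CNilpGradedLieAlg K c) (f : A →ₗ⁅K⁆ E) (g : C →ₗ⁅K⁆ E),
        LieHomIsGraded A E f → LieHomIsGraded C E g → f.comp g0 = g.comp g1 →
        ∃ h : D →ₗ⁅K⁆ E, LieHomIsGraded D E h ∧ h.comp f0 = f ∧ h.comp f1 = g := by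
  classical
  obtain ⟨P, _, _, iA, iC, hcomm, huniv⟩ := exists_lie_pushout g0 g1
  obtain ⟨Q, _, _, jA, jC, hQ, hjA, hjC, hint⟩ := PBW.exists_amalgam g0 g1 hg0 hg1
  obtain ⟨hPQ, hPA, hPC⟩ := huniv Q jA jC hQ
  have hiA : Function.Injective iA := by
    intro a b h
    apply hjA
    rw [← hPA, LieHom.comp_apply, LieHom.comp_apply, h]
  have hiC : Function.Injective iC := by
    intro a b h
    apply hjC
    rw [← hPC, LieHom.comp_apply, LieHom.comp_apply, h]
  have hi : ∀ a d, iA a = iC d → a ∈ Set.range g0 := by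
    intro a d h
    apply hint a d
    rw [← hPA, ← hPC, LieHom.comp_apply, LieHom.comp_apply, h]
  let S : Set (GrAm.Tr c P) := Set.range (GrAm.phi iA) ∪ Set.range (GrAm.phi iC)
  let D0 : LieSubalgebra K (GrAm.Tr c P) := LieSubalgebra.lieSpan K _ S
  have hSD : S ⊆ D0 := LieSubalgebra.subset_lieSpan
  have key : ∀ (V : ℕ → Submodule K P)
      (hV : ∀ i j x y, x ∈ V i → y ∈ V j → i + j ≤ c → ⁅x, y⁆ ∈ V (i + j)),
      (∀ n a, iA (GrAm.pr A n a) ∈ V n) → (∀ n a, iC (GrAm.pr C n a) ∈ V n) →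
      ∀ x ∈ D0, ∀ n, x n ∈ V n := by
    intro V hV h1 h2 x hx
    have hle : D0 ≤ GrAm.good c V hV := by
      refine LieSubalgebra.lieSpan_le.2 ?_
      rintro _ (⟨a, rfl⟩ | ⟨a, rfl⟩)
      · exact fun n => h1 n a
      · exact fun n => h2 n a
    exact hle hx
  have hbd : ∀ x ∈ D0, ∀ n, (n = 0 ∨ c < n) → x n = 0 := by
    intro x hx n hn
    have := key (fun n => if n = 0 ∨ c < n then ⊥ else ⊤) ?_ ?_ ?_ x hx n
    · simpa [hn] using this
    · intro i j x y hx hy hij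
      by_cases h : i = 0
      · simp only [h, true_or, if_true, Submodule.mem_bot] at hx
        rw [hx, zero_lie]
        exact Submodule.zero_mem _
      · rw [if_neg (by omega)]
        trivial
    · intro n a
      split_ifs with h
      · rcases h with rfl | h
        · simp [GrAm.pr_zero]
        · simp [GrAm.pr_gt A h]
      · trivial
    · intro n a
      split_ifs with h
      · rcases h with rfl | h
        · simp [GrAm.pr_zero]
        · simp [GrAm.pr_gt C h]
      · trivial
  have hphi : ∀ (X : CNilpGradedLieAlg K c) (i : X →ₗ⁅K⁆ P) (n : ℕ) (a : X),
      GrAm.sg (K := K) n (i (GrAm.pr X n a)) = GrAm.phi i (GrAm.pr X n a) := by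
    intro X i n a
    refine GrAm.Tr.ext' fun m => ?_
    rw [GrAm.sg_app, GrAm.phi_app, GrAm.pr_if X m n (GrAm.pr_mem X n a)]
    by_cases h : m = n
    · simp [h]
    · simp [h, Ne.symm h]
  have hD : GrAm.IsGr D0 := by
    refine ⟨fun x hx => hbd x hx 0 (Or.inl rfl), fun x hx n hn => hbd x hx n (Or.inr hn), ?_⟩
    refine key (fun n => D0.toSubmodule.comap (GrAm.sg (K := K) n)) ?_ ?_ ?_
    · intro i j x y hx hy hij
      rw [Submodule.mem_comap, GrAm.sg_lie i j x y hij]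
      exact D0.lie_mem hx hy
    · intro n a
      rw [Submodule.mem_comap, hphi]
      exact hSD (Or.inl ⟨_, rfl⟩)
    · intro n a
      rw [Submodule.mem_comap, hphi]
      exact hSD (Or.inr ⟨_, rfl⟩)
  let f0 : A →ₗ⁅K⁆ D0 :=
    { toFun := fun a => ⟨GrAm.phi iA a, hSD (Or.inl ⟨a, rfl⟩)⟩
      map_add' := fun a b => Subtype.ext (map_add _ a b)
      map_smul' := fun k a => Subtype.ext (map_smul _ k a)
      map_lie' := fun {a b} => Subtype.ext (LieHom.map_lie _ a b) }
  let f1 : C →ₗ⁅K⁆ D0 :=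
    { toFun := fun a => ⟨GrAm.phi iC a, hSD (Or.inr ⟨a, rfl⟩)⟩
      map_add' := fun a b => Subtype.ext (map_add _ a b)
      map_smul' := fun k a => Subtype.ext (map_smul _ k a)
      map_lie' := fun {a b} => Subtype.ext (LieHom.map_lie _ a b) }
  have hf0 : ∀ a n, (f0 a).1 n = iA (GrAm.pr A n a) := fun a n => rfl
  have hf1 : ∀ a n, (f1 a).1 n = iC (GrAm.pr C n a) := fun a n => rfl
  have hs0 : ∀ a, ∑ n ∈ Finset.range (c + 1), (f0 a).1 n = iA a := by
    intro a
    simp only [hf0]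
    rw [← map_sum, GrAm.sum_pr]
  have hs1 : ∀ a, ∑ n ∈ Finset.range (c + 1), (f1 a).1 n = iC a := by
    intro a
    simp only [hf1]
    rw [← map_sum, GrAm.sum_pr]
  have hff : ∀ b, f0 (g0 b) = f1 (g1 b) := by
    intro b
    refine Subtype.ext (GrAm.Tr.ext' fun n => ?_)
    rw [hf0, hf1, GrAm.pr_hom g0 hg0', GrAm.pr_hom g1 hg1']
    exact LieHom.congr_fun hcomm _
  refine ⟨GrAm.mkD D0 hD, f0, f1, ?_, ?_, ?_, ?_, ?_, ?_, ?_, ?_⟩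
  · intro a b h
    have h : f0 a = f0 b := h
    apply hiA
    rw [← hs0, ← hs0, h]
  · intro i x hx m hm
    refine (hf0 x m).trans ?_
    rw [GrAm.pr_ne A hx (Ne.symm hm), map_zero]
  · intro a b h
    have h : f1 a = f1 b := h
    apply hiC
    rw [← hs1, ← hs1, h]
  · intro i x hx m hm
    refine (hf1 x m).trans ?_
    rw [GrAm.pr_ne C hx (Ne.symm hm), map_zero]
  · ext1 b
    exact hff b
  · apply Set.Subset.antisymm
    · rintro _ ⟨⟨a, rfl⟩, ⟨d, h⟩⟩
      have h : f1 d = f0 a := h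
      obtain ⟨b, rfl⟩ := hi a d (by rw [← hs0, ← hs1, h])
      exact ⟨b, rfl⟩
    · rintro _ ⟨b, rfl⟩
      exact ⟨⟨g0 b, rfl⟩, ⟨g1 b, (hff b).symm⟩⟩
  · change LieSubalgebra.lieSpan K D0 (Set.range f0 ∪ Set.range f1) = ⊤
    rw [eq_top_iff]
    have hle : D0 ≤ (LieSubalgebra.lieSpan K D0 (Set.range f0 ∪ Set.range f1)).map D0.incl := by
      refine LieSubalgebra.lieSpan_le.2 ?_
      rintro _ (⟨a, rfl⟩ | ⟨a, rfl⟩)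
      · exact ⟨f0 a, LieSubalgebra.subset_lieSpan (Or.inl ⟨a, rfl⟩), rfl⟩
      · exact ⟨f1 a, LieSubalgebra.subset_lieSpan (Or.inr ⟨a, rfl⟩), rfl⟩
    rintro x -
    obtain ⟨y, hy, hyx⟩ := hle x.2
    have : y = x := Subtype.ext hyx
    rw [← this]
    exact hy
  · intro E f g hf hg hfg
    obtain ⟨h0, h0A, h0C⟩ := huniv E f g hfg
    have h0A' : ∀ a, h0 (iA a) = f a := fun a => LieHom.congr_fun h0A a
    have h0C' : ∀ a, h0 (iC a) = g a := fun a => LieHom.congr_fun h0C a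
    have hpc : ∀ x ∈ D0, ∀ n, h0 (x n) ∈ E.piece n := by
      refine key (fun n => (E.piece n).comap (h0 : P →ₗ[K] E)) ?_ ?_ ?_
      · intro i j x y hx hy _
        rw [Submodule.mem_comap] at hx hy ⊢
        have := E.lie_mem i j _ _ hx hy
        rw [LieHom.coe_toLinearMap] at this ⊢
        rwa [LieHom.map_lie]
      · intro n a
        rw [Submodule.mem_comap, LieHom.coe_toLinearMap, h0A']
        exact hf n _ (GrAm.pr_mem A n a)
      · intro n a
        rw [Submodule.mem_comap, LieHom.coe_toLinearMap, h0C']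
        exact hg n _ (GrAm.pr_mem C n a)
    let H : D0 →ₗ[K] E :=
      { toFun := fun x => ∑ n ∈ Finset.range (c + 1), h0 (x.1 n)
        map_add' := fun x y => by
          rw [← Finset.sum_add_distrib]
          refine Finset.sum_congr rfl fun n _ => ?_
          rw [← map_add]
          rfl
        map_smul' := fun k x => by
          rw [Finset.smul_sum]
          refine Finset.sum_congr rfl fun n _ => ?_
          rw [RingHom.id_apply, ← map_smul]
          rfl }
    have hH : ∀ x n, GrAm.pr E n (H x) = h0 (x.1 n) := by
      intro x n
      change GrAm.pr E n (∑ m ∈ Finset.range (c + 1), h0 (x.1 m)) = _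
      rw [map_sum, Finset.sum_congr rfl (fun m _ => GrAm.pr_if E n m (hpc x.1 x.2 m))]
      by_cases hn : n < c + 1
      · rw [Finset.sum_ite_eq']
        simp [hn]
      · rw [hbd x.1 x.2 n (Or.inr (by omega))]
        refine (Finset.sum_eq_zero fun m hm => ?_).trans (map_zero h0).symm
        rw [Finset.mem_range] at hm
        rw [if_neg (by omega)]
    have hHl : ∀ x y : D0, H ⁅x, y⁆ = ⁅H x, H y⁆ := by
      intro x y
      refine GrAm.pr_ext E fun n => ?_
      rw [hH, GrAm.pr_lie]
      simp only [hH]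
      change h0 (⁅x.1, y.1⁆ n) = _
      by_cases hn : n ≤ c
      · rw [GrAm.Tr.lie_le _ _ hn]
        simp
      · rw [GrAm.Tr.lie_gt _ _ hn, map_zero]
        have := GrAm.pr_lie E n (H x) (H y)
        rw [GrAm.pr_gt E (by omega)] at this
        simpa only [hH] using this
    have hHg : ∀ i (x : D0), x ∈ GrAm.pc D0 i → H x ∈ E.piece i := by
      intro i x hx
      have : H x = h0 (x.1 i) := by
        refine GrAm.pr_ext E fun n => ?_
        rw [hH, GrAm.pr_if E n i (hpc _ x.2 i)]
        split_ifs with h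
        · rw [h]
        · rw [hx n (Ne.symm h), map_zero]
      rw [this]
      exact hpc _ x.2 i
    let H' : D0 →ₗ⁅K⁆ E := { H with map_lie' := fun {x y} => hHl x y }
    refine ⟨H', hHg, ?_, ?_⟩
    · ext1 a
      change H (f0 a) = f a
      refine GrAm.pr_ext E fun n => ?_
      rw [hH, hf0, h0A', GrAm.pr_hom f hf]
    · ext1 a
      change H (f1 a) = g a
      refine GrAm.pr_ext E fun n => ?_
      rw [hH, hf1, h0C', GrAm.pr_hom g hg]
end
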